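/- arXiv:2006.06397 — 4 statements merged into one kernel-verified Lean document; each statement's English description precedes it below -/
import Mathlib

section
/- Let F be a field, let C1 ⊆ F^{n1} be a nonzero linear code with minimum distance d1 and C2 ⊆ F^{n2} a nonzero linear code with minimum distance d2. Then the product code C1 × C2 is nonzero and its minimum distance equals d1·d2. -/
/-- The product code of two linear codes `C1 ⊆ F^{n1}` and `C2 ⊆ F^{n2}`:
the set of arrays `c : Fin n1 × Fin n2 → F` all of whose columns lie in `C1`
and all of whose rows lie in `C2`. -/
def productCode {F : Type*} [Field F] {n1 n2 : ℕ}
    (C1 : Submodule F (Fin n1 → F)) (C2 : Submodule F (Fin n2 → F)) :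
    Submodule F (Fin n1 × Fin n2 → F) where
  carrier := {c | (∀ j, (fun i => c (i, j)) ∈ C1) ∧ ∀ i, (fun j => c (i, j)) ∈ C2}
  add_mem' := by
    rintro a b ⟨ha1, ha2⟩ ⟨hb1, hb2⟩
    exact ⟨fun j => C1.add_mem (ha1 j) (hb1 j), fun i => C2.add_mem (ha2 i) (hb2 i)⟩
  zero_mem' := ⟨fun j => C1.zero_mem, fun i => C2.zero_mem⟩
  smul_mem' := by
    rintro r a ⟨ha1, ha2⟩
    exact ⟨fun j => C1.smul_mem r (ha1 j), fun i => C2.smul_mem r (ha2 i)⟩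

/-- `d` is the minimum distance of the (nonzero) linear code `C`: it is the least element
of the set of Hamming weights of nonzero codewords of `C`. -/
def IsMinDist {F : Type*} [Field F] [DecidableEq F] {ι : Type*} [Fintype ι]
    (C : Submodule F (ι → F)) (d : ℕ) : Prop :=
  IsLeast {w | ∃ c ∈ C, c ≠ 0 ∧ hammingNorm c = w} d

theorem hammingNorm_prod {F ι κ : Type*} [Zero F] [DecidableEq F] [Fintype ι] [Fintype κ]
    (c : ι × κ → F) : hammingNorm c = ∑ i, hammingNorm (fun j => c (i, j)) := by
  simp only [hammingNorm, Finset.card_filter, Fintype.sum_prod_type]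

theorem hammingNorm_mul_prod {F ι κ : Type*} [MulZeroClass F] [NoZeroDivisors F] [DecidableEq F]
    [Fintype ι] [Fintype κ] (a : ι → F) (b : κ → F) :
    hammingNorm (fun p : ι × κ => a p.1 * b p.2) = hammingNorm a * hammingNorm b := by
  simp only [hammingNorm, mul_ne_zero_iff]
  rw [← Finset.card_product, ← Finset.filter_product, Finset.univ_product_univ]

/-- If some column of an array has weight at least `d1`, and every nonzero
row has weight at least `d2`, then the array has weight at least `d1 * d2`. -/
theorem mul_le_hammingNorm_prod {F ι κ : Type*} [Zero F] [DecidableEq F] [Fintype ι] [Fintype κ]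
    {d1 d2 : ℕ} (c : ι × κ → F) (j : κ) (hcol : d1 ≤ hammingNorm (fun i => c (i, j)))
    (hrow : ∀ i, (fun j => c (i, j)) ≠ 0 → d2 ≤ hammingNorm (fun j => c (i, j))) :
    d1 * d2 ≤ hammingNorm c := by
  calc d1 * d2 ≤ hammingNorm (fun i => c (i, j)) * d2 := Nat.mul_le_mul_right _ hcol
    _ = ∑ i with c (i, j) ≠ 0, d2 := by simp [hammingNorm]
    _ ≤ ∑ i with c (i, j) ≠ 0, hammingNorm (fun j => c (i, j)) :=
      Finset.sum_le_sum fun i hi =>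
        hrow i fun h => (Finset.mem_filter.1 hi).2 (congrFun h j)
    _ ≤ ∑ i, hammingNorm (fun j => c (i, j)) :=
      Finset.sum_le_sum_of_subset (Finset.filter_subset _ _)
    _ = hammingNorm c := (hammingNorm_prod c).symm

theorem mul_mem_productCode {F : Type*} [Field F] {n1 n2 : ℕ}
    {C1 : Submodule F (Fin n1 → F)} {C2 : Submodule F (Fin n2 → F)}
    {a : Fin n1 → F} {b : Fin n2 → F} (ha : a ∈ C1) (hb : b ∈ C2) :
    (fun p : Fin n1 × Fin n2 => a p.1 * b p.2) ∈ productCode C1 C2 := by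
  refine ⟨fun j => ?_, fun i => C2.smul_mem (a i) hb⟩
  convert C1.smul_mem (b j) ha using 1
  ext i
  simp [mul_comm]

/-- If `C1` is a nonzero linear code with minimum distance `d1` and `C2` a nonzero linear
code with minimum distance `d2`, then the product code `C1 × C2` is nonzero and has
minimum distance `d1 * d2`. -/
theorem productCode_minDist {F : Type*} [Field F] [DecidableEq F] {n1 n2 : ℕ}
    (C1 : Submodule F (Fin n1 → F)) (C2 : Submodule F (Fin n2 → F))
    (hC1 : C1 ≠ ⊥) (hC2 : C2 ≠ ⊥) {d1 d2 : ℕ}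
    (h1 : IsMinDist C1 d1) (h2 : IsMinDist C2 d2) :
    productCode C1 C2 ≠ ⊥ ∧ IsMinDist (productCode C1 C2) (d1 * d2) := by
  obtain ⟨⟨a, ha, ha0, rfl⟩, hmin1⟩ := h1
  obtain ⟨⟨b, hb, hb0, rfl⟩, hmin2⟩ := h2
  have hmem := mul_mem_productCode ha hb
  have hne : (fun p : Fin n1 × Fin n2 => a p.1 * b p.2) ≠ 0 := by
    rw [← hammingNorm_ne_zero_iff, hammingNorm_mul_prod]
    exact mul_ne_zero (hammingNorm_ne_zero_iff.2 ha0) (hammingNorm_ne_zero_iff.2 hb0)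
  refine ⟨(Submodule.ne_bot_iff _).2 ⟨_, hmem, hne⟩,
    ⟨_, hmem, hne, hammingNorm_mul_prod a b⟩, ?_⟩
  rintro _ ⟨c, ⟨hcol, hrow⟩, hc0, rfl⟩
  obtain ⟨⟨i, j⟩, hij⟩ := Function.ne_iff.1 hc0
  exact mul_le_hammingNorm_prod c j
    (hmin1 ⟨_, hcol j, fun h => hij (congrFun h i), rfl⟩)
    fun i hi => hmin2 ⟨_, hrow i, hi, rfl⟩
end

section
/- Let s be a positive integer, q_0 = 2^s, q = 2·q_0², and let F_{q⁴} be the finite field with q⁴ elements. Then the number of pairs (a,b) ∈ F_{q⁴} × F_{q⁴} satisfying b^q + b = a^{q_0}·(a^q + a) equals q⁴ + 2·q_0·q²·(q − 1). -/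
/-- The formal absolute trace `∑_{i < N} x^(2^i)`. -/
def formalTrace {K : Type*} [Semiring K] (N : ℕ) (x : K) : K := ∑ i ∈ Finset.range N, x ^ 2 ^ i

open Classical in
/-- The sign `(-1)^(Tr x)`, read off from the formal trace. -/
noncomputable def traceSign {K : Type*} [Semiring K] (N : ℕ) (x : K) : ℤ :=
  if formalTrace N x = 0 then 1 else -1

section Trace

variable {K : Type*} [Field K] {N : ℕ}

theorem formalTrace_zero : formalTrace N (0 : K) = 0 := by
  simp [formalTrace]

theorem formalTrace_add [CharP K 2] (x y : K) :
    formalTrace N (x + y) = formalTrace N x + formalTrace N y := by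
  simp [formalTrace, add_pow_char_pow, Finset.sum_add_distrib]

theorem formalTrace_sq_eq_pow [CharP K 2] (x : K) : formalTrace N x ^ 2 = formalTrace N (x ^ 2) := by
  simp only [formalTrace]
  rw [sum_pow_char]
  exact Finset.sum_congr rfl fun i _ ↦ by rw [← pow_mul, ← pow_mul, mul_comm]

theorem formalTrace_sq {x : K} (hx : x ^ 2 ^ N = x) : formalTrace N (x ^ 2) = formalTrace N x := by
  have h := Finset.sum_range_succ' (fun i ↦ x ^ 2 ^ i) N
  rw [Finset.sum_range_succ, hx, pow_zero, pow_one] at h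
  have h' := add_right_cancel h
  simp only [formalTrace]
  rw [h']
  exact Finset.sum_congr rfl fun i _ ↦ by rw [← pow_mul, pow_succ']

theorem formalTrace_eq_zero_or_one [CharP K 2] {x : K} (hx : x ^ 2 ^ N = x) :
    formalTrace N x = 0 ∨ formalTrace N x = 1 := by
  have h := formalTrace_sq_eq_pow (N := N) x
  rw [formalTrace_sq hx] at h
  have h' : formalTrace N x * (formalTrace N x - 1) = 0 := by linear_combination h
  rcases mul_eq_zero.1 h' with h0 | h0
  · exact Or.inl h0
  · exact Or.inr (sub_eq_zero.1 h0)

theorem pow_two_pow_mul {m : ℕ} {x : K} (hx : x ^ 2 ^ m = x) (k : ℕ) : x ^ 2 ^ (m * k) = x := by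
  induction k with
  | zero => simp
  | succ k ih => rw [mul_add, mul_one, pow_add, pow_mul, ih, hx]

theorem formalTrace_mul {m k : ℕ} {x : K} (hx : x ^ 2 ^ m = x) :
    formalTrace (m * k) x = k * formalTrace m x := by
  induction k with
  | zero => simp [formalTrace]
  | succ k ih =>
    have h : formalTrace (m * (k + 1)) x = formalTrace (m * k) x + formalTrace m x := by
      simp only [formalTrace]
      rw [mul_add, mul_one, Finset.sum_range_add]
      congr 1
      exact Finset.sum_congr rfl fun i _ ↦ by rw [pow_add, pow_mul, pow_two_pow_mul hx]
    rw [h, ih]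
    push_cast
    ring

theorem traceSign_zero : traceSign N (0 : K) = 1 := by
  simp [traceSign, formalTrace_zero]

theorem traceSign_eq_one_or (x : K) : traceSign N x = 1 ∨ traceSign N x = -1 := by
  unfold traceSign
  split_ifs <;> simp

theorem traceSign_mul_self (x : K) : traceSign N x * traceSign N x = 1 := by
  rcases traceSign_eq_one_or (N := N) x with h | h <;> simp [h]

theorem traceSign_add [CharP K 2] {x y : K} (hx : x ^ 2 ^ N = x) (hy : y ^ 2 ^ N = y) :
    traceSign N (x + y) = traceSign N x * traceSign N y := by
  unfold traceSign
  rw [formalTrace_add]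
  rcases formalTrace_eq_zero_or_one hx with h | h <;>
    rcases formalTrace_eq_zero_or_one hy with h' | h' <;> simp [h, h', CharTwo.add_self_eq_zero]

theorem traceSign_pow [CharP K 2] {x : K} (hx : x ^ 2 ^ N = x) (i : ℕ) :
    traceSign N (x ^ 2 ^ i) = traceSign N x := by
  induction i with
  | zero => simp
  | succ i ih =>
    rw [← ih, pow_succ, pow_mul]
    unfold traceSign
    rw [formalTrace_sq]
    rw [← pow_mul, mul_comm, pow_mul, hx]

end Trace

section FiniteField

variable {K : Type*} [Field K] [Fintype K] {N : ℕ}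

theorem pow_two_pow_eq_self (hK : Fintype.card K = 2 ^ N) (x : K) : x ^ 2 ^ N = x := by
  rw [← hK, FiniteField.pow_card]

open Classical in
theorem card_pow_two_pow_eq_self (hK : Fintype.card K = 2 ^ N) (d : ℕ) :
    (Finset.univ.filter fun x : K ↦ x ^ 2 ^ d = x).card = 2 ^ Nat.gcd N d := by
  have h1 := IsCyclic.card_powMonoidHom_ker (G := Kˣ) (2 ^ d - 1)
  rw [Nat.card_eq_fintype_card (α := Kˣ), Fintype.card_units, hK,
    Nat.pow_sub_one_gcd_pow_sub_one] at h1
  have h2 : (Finset.univ.filter fun x : K ↦ x ^ 2 ^ d = x) =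
      insert 0 ((Finset.univ.filter fun u : Kˣ ↦ u ^ (2 ^ d - 1) = 1).map
        ⟨Units.val, Units.val_injective⟩) := by
    ext x
    simp only [Finset.mem_filter, Finset.mem_univ, true_and, Finset.mem_insert, Finset.mem_map,
      Function.Embedding.coeFn_mk]
    constructor
    · intro hx
      by_cases h0 : x = 0
      · exact Or.inl h0
      · refine Or.inr ⟨Units.mk0 x h0, ?_, rfl⟩
        ext
        push_cast
        rw [Units.val_mk0]
        apply mul_right_cancel₀ h0
        rw [← pow_succ, Nat.sub_add_cancel Nat.one_le_two_pow, hx, one_mul]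
    · rintro (rfl | ⟨u, hu, rfl⟩)
      · simp
      · have := congrArg (fun v : Kˣ ↦ ((v * u : Kˣ) : K)) hu
        simpa [← pow_succ, Nat.sub_add_cancel Nat.one_le_two_pow] using this
  rw [h2, Finset.card_insert_of_notMem (by simp), Finset.card_map]
  have h3 : (Finset.univ.filter fun u : Kˣ ↦ u ^ (2 ^ d - 1) = 1).card = 2 ^ Nat.gcd N d - 1 := by
    rw [← h1, Nat.card_eq_fintype_card, ← Fintype.card_coe]
    exact Fintype.card_congr (Equiv.subtypeEquivRight fun u ↦ by simp [MonoidHom.mem_ker])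
  rw [h3, Nat.sub_add_cancel Nat.one_le_two_pow]

theorem exists_traceSign_eq_neg_one (hN : N ≠ 0) (hK : Fintype.card K = 2 ^ N) :
    ∃ x : K, traceSign N x = -1 := by
  classical
  by_contra! hne
  have h0 (x : K) : formalTrace N x = 0 := by
    by_contra h
    exact hne x (by simp [traceSign, h])
  obtain ⟨M, rfl⟩ := Nat.exists_eq_succ_of_ne_zero hN
  let P : Polynomial K := ∑ i ∈ Finset.range (M + 1), Polynomial.X ^ 2 ^ i
  have hc : P.coeff (2 ^ M) = 1 := by
    simp [P, Polynomial.coeff_X_pow]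
  have hP : P ≠ 0 := fun h ↦ by simp [h] at hc
  have hd : P.natDegree ≤ 2 ^ M := by
    apply Polynomial.natDegree_sum_le_of_forall_le
    intro i hi
    rw [Polynomial.natDegree_X_pow]
    exact Nat.pow_le_pow_right (by norm_num) (by simpa [Nat.lt_succ_iff] using hi)
  have h1 : Fintype.card K ≤ P.natDegree := by
    rw [← Finset.card_univ]
    apply Polynomial.card_le_degree_of_subset_roots
    intro x _
    rw [Polynomial.mem_roots hP, Polynomial.IsRoot]
    simpa [P, Polynomial.eval_finsetSum, formalTrace] using h0 x
  rw [hK] at h1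
  have h2 := h1.trans hd
  have := Nat.pow_lt_pow_right (a := 2) (by norm_num) (Nat.lt_succ_self M)
  omega

theorem sum_traceSign_mul [CharP K 2] [DecidableEq K] (hN : N ≠ 0) (hK : Fintype.card K = 2 ^ N)
    (c : K) :
    ∑ x : K, traceSign N (x * c) = if c = 0 then 2 ^ N else 0 := by
  split_ifs with hc
  · simp [hc, traceSign_zero, hK]
  · obtain ⟨y, hy⟩ := exists_traceSign_eq_neg_one hN hK
    have h := Fintype.sum_equiv (Equiv.addRight (y * c⁻¹))
      (fun x ↦ traceSign N ((x + y * c⁻¹) * c)) (fun x ↦ traceSign N (x * c)) fun x ↦ rfl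
    simp only [add_mul, inv_mul_cancel_right₀ hc] at h
    simp only [traceSign_add (pow_two_pow_eq_self hK _) (pow_two_pow_eq_self hK _), hy,
      ← Finset.sum_mul] at h
    linarith

theorem sum_traceSign_pow_mul [CharP K 2] [DecidableEq K] (hN : N ≠ 0)
    (hK : Fintype.card K = 2 ^ N) (i : ℕ) (c : K) :
    ∑ x : K, traceSign N (x ^ 2 ^ i * c) = if c = 0 then 2 ^ N else 0 := by
  rw [← sum_traceSign_mul hN hK]
  exact Fintype.sum_equiv (iterateFrobeniusEquiv K 2 i).toEquiv _ _ fun x ↦ rfl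

end FiniteField

section SuzukiSum

/-- The right-hand side `x^(2^s) (x^(2^l) + x)` of the equation of the Suzuki curve. -/
def suzukiTerm {K : Type*} [Semiring K] (s l : ℕ) (x : K) : K := x ^ 2 ^ s * (x ^ 2 ^ l + x)

/-- The sum over `K` of `(-1)^(Tr (x^(2^s) (x^(2^l) + x)))`. -/
noncomputable def suzukiSum (K : Type*) [Semiring K] [Fintype K] (N s l : ℕ) : ℤ :=
  ∑ x : K, traceSign N (suzukiTerm s l x)

variable {K : Type*} [Field K] [Fintype K] [CharP K 2]

open Classical in
theorem card_suzuki_eq_sum {N s l : ℕ} (hN : N ≠ 0) (hK : Fintype.card K = 2 ^ N) :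
    ((Finset.univ.filter fun p : K × K ↦
      p.2 ^ 2 ^ l + p.2 = p.1 ^ 2 ^ s * (p.1 ^ 2 ^ l + p.1)).card : ℤ) =
      ∑ t ∈ Finset.univ.filter (fun t : K ↦ t ^ 2 ^ l = t),
        ∑ x : K, traceSign N (t * suzukiTerm s l x) := by
  have hb (t : K) : ∑ b : K, traceSign N (t * (b ^ 2 ^ l + b)) =
      if t ^ 2 ^ l = t then 2 ^ N else 0 := by
    have h (b : K) : traceSign N (t * (b ^ 2 ^ l + b)) =
        traceSign N (b ^ 2 ^ l * (t ^ 2 ^ l + t)) := by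
      rw [mul_add, mul_add, mul_comm t (b ^ 2 ^ l), add_comm (b ^ 2 ^ l * t), ← mul_pow,
        traceSign_add (pow_two_pow_eq_self hK _) (pow_two_pow_eq_self hK _),
        traceSign_add (pow_two_pow_eq_self hK _) (pow_two_pow_eq_self hK _),
        traceSign_pow (pow_two_pow_eq_self hK _), mul_comm b t]
    simp_rw [h, sum_traceSign_pow_mul hN hK, CharTwo.add_eq_zero]
  have h1 : (2 ^ N : ℤ) * ((Finset.univ.filter fun p : K × K ↦
      p.2 ^ 2 ^ l + p.2 = p.1 ^ 2 ^ s * (p.1 ^ 2 ^ l + p.1)).card : ℤ) =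
      ∑ p : K × K, ∑ t : K, traceSign N (t * (p.2 ^ 2 ^ l + p.2 + suzukiTerm s l p.1)) := by
    simp_rw [sum_traceSign_mul hN hK, CharTwo.add_eq_zero]
    rw [← Finset.sum_filter, Finset.sum_const, nsmul_eq_mul, mul_comm]
    rfl
  apply mul_left_cancel₀ (pow_ne_zero N (two_ne_zero (α := ℤ)))
  rw [h1, Finset.sum_comm, Finset.sum_filter, Finset.mul_sum]
  refine Finset.sum_congr rfl fun t _ ↦ ?_
  rw [Fintype.sum_prod_type]
  simp_rw [mul_add t (_ + _) (suzukiTerm _ _ _),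
    traceSign_add (pow_two_pow_eq_self hK _) (pow_two_pow_eq_self hK _), ← Finset.sum_mul, hb,
    ← Finset.mul_sum]
  split_ifs <;> simp

omit [CharP K 2] in
theorem sum_traceSign_mul_suzukiTerm {N s : ℕ} {t : K} (ht : t ≠ 0)
    (htl : t ^ 2 ^ (2 * s + 1) = t) :
    ∑ x : K, traceSign N (t * suzukiTerm s (2 * s + 1) x) = suzukiSum K N s (2 * s + 1) := by
  obtain ⟨r, hr⟩ : ∃ r, 2 ^ s = r + 1 := ⟨2 ^ s - 1, (Nat.sub_add_cancel Nat.one_le_two_pow).symm⟩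
  have hl : 2 ^ (2 * s + 1) = (2 * r) * (2 ^ s + 1) + 2 := by
    rw [pow_succ, mul_comm 2 s, pow_mul, hr]
    ring
  set c := t⁻¹ ^ (2 * r) with hc
  have hc0 : c ≠ 0 := pow_ne_zero _ (inv_ne_zero ht)
  have hcl : c ^ 2 ^ (2 * s + 1) = c := by
    rw [hc, ← pow_mul, mul_comm, pow_mul, inv_pow, htl]
  have hcs : c ^ 2 ^ s * c = t := by
    have h1 : t ^ (2 * r * (2 ^ s + 1)) * t = 1 := by
      apply mul_right_cancel₀ ht
      rw [one_mul, mul_assoc, ← pow_two, ← pow_add, ← hl, htl]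
    rw [← pow_succ, hc, ← pow_mul, inv_pow]
    exact (eq_inv_of_mul_eq_one_right h1).symm
  refine Fintype.sum_equiv (Equiv.mulLeft₀ c hc0) _ _ fun x ↦ ?_
  congr 1
  simp only [suzukiTerm, Equiv.mulLeft₀_apply, mul_pow, hcl]
  rw [← hcs]
  ring

omit [Fintype K] in
theorem suzukiTerm_add (s l : ℕ) (x y : K) : suzukiTerm s l (x + y) =
    suzukiTerm s l x + suzukiTerm s l y +
      (x ^ 2 ^ s * (y ^ 2 ^ l + y) + y ^ 2 ^ s * (x ^ 2 ^ l + x)) := by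
  simp only [suzukiTerm, add_pow_char_pow]
  ring

theorem gcd_four_mul_of_dvd {n l : ℕ} (hl : Odd l) (hn : n ∣ l) : Nat.gcd (4 * n) l = n := by
  obtain ⟨c, rfl⟩ := hn
  have hc : Nat.Coprime 4 c := (Nat.coprime_pow_left_iff (n := 2) (by norm_num) 2 c).2
    (Nat.coprime_two_left.2 (Nat.odd_mul.1 hl).2)
  rw [mul_comm 4 n, Nat.gcd_mul_left, hc, mul_one]

open Classical in
theorem card_pow_add_self_eq_one_of_exists {N l : ℕ} (hK : Fintype.card K = 2 ^ N)
    (hw : ∃ w : K, w ^ 2 ^ l + w = 1) :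
    (Finset.univ.filter fun x : K ↦ x ^ 2 ^ l + x = 1).card = 2 ^ Nat.gcd N l := by
  obtain ⟨w, hw⟩ := hw
  rw [← card_pow_two_pow_eq_self hK l]
  refine Finset.card_equiv (Equiv.addRight w) fun x ↦ ?_
  simp only [Finset.mem_filter, Finset.mem_univ, true_and, Equiv.coe_addRight, add_pow_char_pow]
  constructor <;> intro hx
  · linear_combination hx + hw - (x + w - 1) * CharTwo.two_eq_zero (R := K)
  · linear_combination hx - hw + (w + x - 1) * CharTwo.two_eq_zero (R := K)

open Classical in
theorem card_pow_add_self_eq_one {n l : ℕ} (hl : Odd l) (hn : n ∣ l)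
    (hK : Fintype.card K = 2 ^ (4 * n)) :
    (Finset.univ.filter fun x : K ↦ x ^ 2 ^ l + x = 1).card = 2 ^ n := by
  obtain ⟨w, hw⟩ : ∃ w : K, w ^ 2 + w = 1 := by
    have h4 := card_pow_two_pow_eq_self hK 2
    rw [Nat.gcd_eq_right (show 2 ∣ 4 * n from ⟨2 * n, by ring⟩)] at h4
    by_contra! hne
    have hsub : (Finset.univ.filter fun x : K ↦ x ^ 2 ^ 2 = x) ⊆ {0, 1} := by
      intro x hx
      simp only [Finset.mem_filter, Finset.mem_univ, true_and] at hx
      simp only [Finset.mem_insert, Finset.mem_singleton]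
      have h : (x * (x + 1)) * (x ^ 2 + x + 1) = 0 := by
        linear_combination hx + (x ^ 3 + x ^ 2 + x) * CharTwo.two_eq_zero (R := K)
      rcases mul_eq_zero.1 h with h | h
      · rcases mul_eq_zero.1 h with h | h
        · exact Or.inl h
        · exact Or.inr (CharTwo.add_eq_zero.1 h)
      · exact absurd (CharTwo.add_eq_zero.1 h) (hne x)
    have := (Finset.card_le_card hsub).trans Finset.card_le_two
    omega
  rw [card_pow_add_self_eq_one_of_exists hK ⟨w, ?_⟩, gcd_four_mul_of_dvd hl hn]
  obtain ⟨c, rfl⟩ := hl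
  have h4 : w ^ 2 ^ 2 = w := by
    linear_combination (w ^ 2 - w) * hw - (w - w ^ 2) * CharTwo.two_eq_zero (R := K)
  rw [pow_succ, pow_mul, pow_two_pow_mul h4, hw]

theorem suzukiSum_sq {n s : ℕ} (hn : n ∣ 2 * s + 1) (hK : Fintype.card K = 2 ^ (4 * n)) :
    suzukiSum K (4 * n) s (2 * s + 1) ^ 2 = 2 ^ (5 * n + 1) := by
  classical
  have hn0 : n ≠ 0 := by
    rintro rfl
    simp at hn
  have hl : Odd (2 * s + 1) := ⟨s, rfl⟩
  set l := 2 * s + 1 with hls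
  set N := 4 * n with hN
  have hN0 : N ≠ 0 := by omega
  have hx (x : K) : x ^ 2 ^ N = x := pow_two_pow_eq_self hK x
  have hcross (h : K) : ∑ x : K, traceSign N
      (x ^ 2 ^ s * (h ^ 2 ^ l + h) + h ^ 2 ^ s * (x ^ 2 ^ l + x)) =
        if h ^ 2 ^ l + h = 0 ∨ h ^ 2 ^ l + h = 1 then 2 ^ N else 0 := by
    generalize hw : h ^ 2 ^ l + h = w
    have h1 (x : K) : traceSign N (x ^ 2 ^ s * w + h ^ 2 ^ s * (x ^ 2 ^ l + x)) =
        traceSign N (x ^ 2 ^ l * (w ^ 2 ^ (s + 1) + w ^ 2 ^ s)) := by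
      have e1 : traceSign N (x ^ 2 ^ s * w) = traceSign N (x ^ 2 ^ l * w ^ 2 ^ (s + 1)) := by
        rw [← traceSign_pow (hx _) (s + 1), mul_pow, ← pow_mul, ← pow_add,
          show s + (s + 1) = l by omega]
      have e2 : traceSign N (h ^ 2 ^ s * x) = traceSign N (x ^ 2 ^ l * (h ^ 2 ^ l) ^ 2 ^ s) := by
        rw [← traceSign_pow (hx _) l, mul_pow, ← pow_mul, ← pow_mul, mul_comm, mul_comm (2 ^ s)]
      rw [mul_add, traceSign_add (hx _) (hx _), traceSign_add (hx _) (hx _), e1, e2,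
        mul_add, traceSign_add (hx _) (hx _), ← hw, add_pow_char_pow (p := 2) (n := s), mul_add,
        traceSign_add (hx (x ^ 2 ^ l * (h ^ 2 ^ l) ^ 2 ^ s)) (hx _), mul_comm (h ^ 2 ^ s)]
      ring
    simp_rw [h1, sum_traceSign_pow_mul hN0 hK]
    congr 1
    have h2 : w ^ 2 ^ (s + 1) + w ^ 2 ^ s = (w * (w + 1)) ^ 2 ^ s := by
      rw [mul_pow, add_pow_char_pow, one_pow, pow_succ, pow_mul]
      ring
    rw [h2, pow_eq_zero_iff (by positivity), mul_eq_zero, CharTwo.add_eq_zero (b := (1 : K))]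
  have hsq : suzukiSum K N s l ^ 2 = ∑ h : K, ∑ x : K,
      traceSign N (suzukiTerm s l (x + h)) * traceSign N (suzukiTerm s l x) := by
    rw [Finset.sum_comm, pow_two]
    nth_rewrite 2 [suzukiSum]
    rw [Finset.mul_sum]
    refine Finset.sum_congr rfl fun x _ ↦ ?_
    rw [← Finset.sum_mul]
    congr 1
    exact (Fintype.sum_equiv (Equiv.addLeft x) _ _ fun h ↦ rfl).symm
  have hterm (h : K) : ∑ x : K,
      traceSign N (suzukiTerm s l (x + h)) * traceSign N (suzukiTerm s l x) =
        if h ^ 2 ^ l + h = 0 ∨ h ^ 2 ^ l + h = 1 then 2 ^ N else 0 := by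
    have h1 (x : K) : traceSign N (suzukiTerm s l (x + h)) * traceSign N (suzukiTerm s l x) =
        traceSign N (suzukiTerm s l h) * traceSign N
          (x ^ 2 ^ s * (h ^ 2 ^ l + h) + h ^ 2 ^ s * (x ^ 2 ^ l + x)) := by
      rw [suzukiTerm_add, traceSign_add (hx _) (hx _), traceSign_add (hx _) (hx _)]
      linear_combination (traceSign N (suzukiTerm s l h) * traceSign N
          (x ^ 2 ^ s * (h ^ 2 ^ l + h) + h ^ 2 ^ s * (x ^ 2 ^ l + x))) *
            traceSign_mul_self (N := N) (suzukiTerm s l x)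
    simp_rw [h1, ← Finset.mul_sum, hcross]
    split_ifs with hw
    · suffices traceSign N (suzukiTerm s l h) = 1 by rw [this, one_mul]
      rcases hw with hw | hw
      · rw [suzukiTerm, hw, mul_zero, traceSign_zero]
      · rw [suzukiTerm, hw, mul_one, traceSign_pow (hx _)]
        have h2l : h ^ 2 ^ (2 * l) = h := by
          have h2 : h ^ 2 ^ l = h + 1 := by
            linear_combination hw - h * CharTwo.two_eq_zero (R := K)
          rw [two_mul, pow_add, pow_mul, h2, add_pow_char_pow, h2, one_pow, add_assoc,
            CharTwo.add_self_eq_zero, add_zero]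
        have h2n : h ^ 2 ^ (2 * n) = h := by
          have hp (a b : ℕ) : h ^ 2 ^ (a * b) = (fun y : K ↦ y ^ 2 ^ a)^[b] h := by
            induction b with
            | zero => simp
            | succ b ih => rw [Function.iterate_succ_apply', ← ih, mul_add, mul_one, pow_add, pow_mul]
          have hp' (a : ℕ) : (h ^ 2 ^ a = h) ↔ Function.IsPeriodicPt (fun y : K ↦ y ^ 2) a h := by
            have := hp 1 a
            rw [one_mul, pow_one] at this
            rw [this]
            rfl
          rw [hp'] at h2l ⊢
          have hNp := (hp' N).1 (hx h)
          have := hNp.gcd h2l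
          rwa [hN, show 4 * n = 2 * (2 * n) by ring, Nat.gcd_mul_left,
            show Nat.gcd (2 * n) l = n from Nat.dvd_antisymm
              ((Nat.gcd_dvd_gcd_mul_left_left (2 * n) l 2).trans (by
                rw [show 2 * (2 * n) = 4 * n by ring, gcd_four_mul_of_dvd hl hn]))
              (Nat.dvd_gcd (dvd_mul_left n 2) hn)] at this
        unfold traceSign
        rw [hN, show 4 * n = (2 * n) * 2 by ring, formalTrace_mul h2n]
        simp [CharTwo.two_eq_zero]
    · simp
  rw [hsq]
  simp_rw [hterm]
  rw [← Finset.sum_filter, Finset.sum_const, Finset.filter_or, Finset.card_union_of_disjoint,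
    card_pow_add_self_eq_one hl hn hK]
  · have h := card_pow_two_pow_eq_self hK l
    rw [gcd_four_mul_of_dvd hl hn] at h
    simp_rw [CharTwo.add_eq_zero]
    rw [h, nsmul_eq_mul, hN]
    push_cast
    ring
  · rw [Finset.disjoint_filter]
    intro x _ h0 h1
    rw [h0] at h1
    exact zero_ne_one h1

omit [Fintype K] in
theorem formalTrace_four_cube {x : K} (hx : x ^ 2 ^ 4 = x) :
    formalTrace 4 (x ^ 3) = (x ^ 2 ^ 2 + x) ^ 3 := by
  simp only [formalTrace, Finset.sum_range_succ, Finset.sum_range_zero]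
  linear_combination x ^ 8 * hx - (x ^ 9 + x ^ 6) * CharTwo.two_eq_zero (R := K)

omit [Fintype K] in
theorem traceSign_four_pow_five {x : K} (hx : x ^ 2 ^ 4 = x) : traceSign 4 (x ^ 5) = 1 := by
  have h : formalTrace 4 (x ^ 5) = 0 := by
    simp only [formalTrace, Finset.sum_range_succ, Finset.sum_range_zero]
    linear_combination (x ^ 4 + x ^ 24 + x ^ 9) * hx +
      (x ^ 5 + x ^ 10) * CharTwo.two_eq_zero (R := K)
  simp [traceSign, h]

theorem sum_traceSign_cube (hK : Fintype.card K = 2 ^ 4) :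
    ∑ x : K, traceSign 4 (x ^ 3) = -8 := by
  classical
  have hx (x : K) : x ^ 2 ^ 4 = x := pow_two_pow_eq_self hK x
  have h (x : K) : traceSign 4 (x ^ 3) = 2 * (if x ^ 2 ^ 2 = x then 1 else 0) - 1 := by
    unfold traceSign
    rw [formalTrace_four_cube (hx x), pow_eq_zero_iff (by norm_num), CharTwo.add_eq_zero]
    split_ifs <;> norm_num
  simp_rw [h]
  rw [Finset.sum_sub_distrib, ← Finset.mul_sum, Finset.sum_boole, card_pow_two_pow_eq_self hK]
  simp [hK]

theorem sum_traceSign_cube_mul (hK : Fintype.card K = 2 ^ 4)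
    (hsq : (∑ x : K, traceSign 4 (x ^ 3) * traceSign 4 x) ^ 2 = 64) :
    ∑ x : K, traceSign 4 (x ^ 3) * traceSign 4 x = 8 := by
  classical
  have hx (x : K) : x ^ 2 ^ 4 = x := pow_two_pow_eq_self hK x
  have h (x : K) : traceSign 4 (x ^ 3) * traceSign 4 x =
      1 - 2 * (if x ^ 2 ^ 2 + x = 1 then 1 else 0) := by
    rw [← traceSign_add (hx _) (hx _)]
    unfold traceSign
    rw [formalTrace_add, formalTrace_four_cube (hx x),
      show formalTrace 4 x = (x ^ 2 ^ 2 + x) ^ 2 + (x ^ 2 ^ 2 + x) by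
        simp only [formalTrace, Finset.sum_range_succ, Finset.sum_range_zero]
        linear_combination -x ^ 5 * CharTwo.two_eq_zero (R := K)]
    have hu : (x ^ 2 ^ 2 + x) ^ 2 ^ 2 = x ^ 2 ^ 2 + x := by
      rw [add_pow_char_pow, ← pow_mul, ← pow_add, hx, add_comm]
    generalize x ^ 2 ^ 2 + x = u at hu ⊢
    by_cases h1 : u = 1
    · simp [h1, CharTwo.add_self_eq_zero]
    · have : u ^ 3 + (u ^ 2 + u) = 0 := by
        apply mul_right_cancel₀ (sub_ne_zero.2 h1)
        linear_combination hu
      simp [this, h1]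
  simp_rw [h] at hsq ⊢
  rw [Finset.sum_sub_distrib, ← Finset.mul_sum, Finset.sum_boole] at hsq ⊢
  by_cases hw : ∃ w : K, w ^ 2 ^ 2 + w = 1
  · rw [card_pow_add_self_eq_one_of_exists hK hw]
    simp [hK]
  · rw [Finset.filter_false_of_mem fun x _ h ↦ hw ⟨x, h⟩] at hsq
    simp [hK] at hsq

theorem suzukiSum_of_card_eq_sixteen (s : ℕ) (hK : Fintype.card K = 2 ^ 4) :
    suzukiSum K 4 s (2 * s + 1) = jacobiSym 2 (2 * s + 1) * 8 := by
  have hx (x : K) : x ^ 2 ^ 4 = x := pow_two_pow_eq_self hK x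
  have hsq := suzukiSum_sq (K := K) (n := 1) (s := s) (one_dvd _) hK
  norm_num at hsq
  rw [jacobiSym.at_two ⟨s, rfl⟩]
  have hmod (j r : ℕ) (x : K) : x ^ 2 ^ (4 * j + r) = x ^ 2 ^ r := by
    rw [pow_add, pow_mul, pow_two_pow_mul (hx x)]
  have hsum : ∀ j r, s = 4 * j + r → suzukiSum K 4 s (2 * s + 1) =
      ∑ x : K, traceSign 4 (x ^ 2 ^ r * x ^ 2 ^ (2 * r + 1)) * traceSign 4 (x ^ 2 ^ r * x) := by
    rintro j r rfl
    refine Finset.sum_congr rfl fun x _ ↦ ?_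
    rw [suzukiTerm, show 2 * (4 * j + r) + 1 = 4 * (2 * j) + (2 * r + 1) by ring, hmod, hmod,
      mul_add, traceSign_add (hx _) (hx _)]
  obtain ⟨j, r, hr, hs⟩ : ∃ j r, r < 4 ∧ s = 4 * j + r := ⟨s / 4, s % 4, by omega, by omega⟩
  have hχ : ZMod.χ₈ ((2 * s + 1 : ℕ) : ZMod 8) = ZMod.χ₈ ((2 * r + 1 : ℕ) : ZMod 8) := by
    rw [hs]
    congr 1
    rw [ZMod.natCast_eq_natCast_iff']
    omega
  have hS := hsum j r hs
  rw [hχ]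
  have hpow (x : K) (i : ℕ) := traceSign_pow (hx x) i
  have hcube (hr : ∀ x : K, traceSign 4 (x ^ 2 ^ r * x ^ 2 ^ (2 * r + 1)) *
      traceSign 4 (x ^ 2 ^ r * x) = traceSign 4 (x ^ 3)) :
      suzukiSum K 4 s (2 * s + 1) = -8 := by
    rw [hS, ← sum_traceSign_cube hK]
    exact Finset.sum_congr rfl fun x _ ↦ hr x
  have hcube_mul (hr : ∀ x : K, traceSign 4 (x ^ 2 ^ r * x ^ 2 ^ (2 * r + 1)) *
      traceSign 4 (x ^ 2 ^ r * x) = traceSign 4 (x ^ 3) * traceSign 4 x) :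
      suzukiSum K 4 s (2 * s + 1) = 8 := by
    rw [hS, Finset.sum_congr rfl fun x _ ↦ hr x] at hsq ⊢
    exact sum_traceSign_cube_mul hK hsq
  interval_cases r
  · rw [hcube_mul fun x ↦ ?_]
    · decide
    · rw [← hpow x 1]
      ring_nf
  · rw [hcube fun x ↦ ?_]
    · decide
    · rw [show x ^ 2 ^ 1 * x ^ 2 ^ (2 * 1 + 1) = (x ^ 5) ^ 2 ^ 1 by ring,
        show x ^ 2 ^ 1 * x = x ^ 3 by ring, traceSign_pow (hx _), traceSign_four_pow_five (hx x),
        one_mul]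
  · rw [hcube fun x ↦ ?_]
    · decide
    · rw [hmod 1 1, show x ^ 2 ^ 2 * x ^ 2 ^ 1 = (x ^ 3) ^ 2 ^ 1 by ring,
        show x ^ 2 ^ 2 * x = x ^ 5 by ring, traceSign_pow (hx _), traceSign_four_pow_five (hx x),
        mul_one]
  · rw [hcube_mul fun x ↦ ?_]
    · decide
    · rw [hmod 1 3, show x ^ 2 ^ 3 * x ^ 2 ^ 3 = x ^ 2 ^ 4 by ring, hx, mul_comm,
        ← traceSign_pow (hx (x ^ 3)) 3]
      congr 2
      linear_combination -x ^ 8 * hx x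

theorem traceSign_suzukiTerm_pow {N : ℕ} (hK : Fintype.card K = 2 ^ N) (s l i : ℕ) (x : K) :
    traceSign N (suzukiTerm s l (x ^ 2 ^ i)) = traceSign N (suzukiTerm s l x) := by
  rw [← traceSign_pow (pow_two_pow_eq_self hK (suzukiTerm s l x)) i]
  congr 1
  simp only [suzukiTerm, mul_pow, add_pow_char_pow, ← pow_mul, mul_comm (2 ^ i)]

open Classical in
omit [CharP K 2] in
theorem suzukiSum_eq_card (N s l : ℕ) : suzukiSum K N s l =
    2 * (Fintype.card {x : K // traceSign N (suzukiTerm s l x) = 1} : ℤ) - Fintype.card K := by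
  have h (x : K) : traceSign N (suzukiTerm s l x) =
      2 * (if traceSign N (suzukiTerm s l x) = 1 then 1 else 0) - 1 := by
    rcases traceSign_eq_one_or (N := N) (suzukiTerm s l x) with h | h <;> simp [h]
  rw [suzukiSum, Finset.sum_congr rfl fun x _ ↦ h x, Finset.sum_sub_distrib, ← Finset.mul_sum,
    Finset.sum_boole, Fintype.card_subtype]
  simp

theorem exists_subfield_suzukiSum_modEq {p m s l : ℕ} (hp : p.Prime) (hp2 : p ≠ 2)
    (hK : Fintype.card K = 2 ^ (4 * (p * m))) :
    ∃ (L : Subfield K) (_ : Fintype L), Fintype.card L = 2 ^ (4 * m) ∧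
      suzukiSum K (4 * (p * m)) s l ≡ suzukiSum L (4 * m) s l [ZMOD p] := by
  classical
  have := Fact.mk hp
  let L : Subfield K := RingHom.eqLocusField (iterateFrobenius K 2 (4 * m)) (RingHom.id K)
  have hL (x : K) : x ∈ L ↔ x ^ 2 ^ (4 * m) = x := Iff.rfl
  have hcard : Fintype.card L = 2 ^ (4 * m) := by
    have h := card_pow_two_pow_eq_self hK (4 * m)
    rw [Nat.gcd_eq_right ⟨p, by ring⟩] at h
    rw [← h, ← Fintype.card_subtype]
    exact Fintype.card_congr (Equiv.subtypeEquivRight hL)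
  refine ⟨L, inferInstance, hcard, ?_⟩
  set N := 4 * (p * m) with hN
  let Z := {x : K // traceSign N (suzukiTerm s l x) = 1}
  let f : Function.End Z := fun x ↦
    ⟨x.1 ^ 2 ^ (4 * m), by rw [traceSign_suzukiTerm_pow hK, x.2]⟩
  have hf (k : ℕ) (x : Z) : ((f ^ k) x).1 = x.1 ^ 2 ^ (4 * m * k) := by
    induction k with
    | zero => simp only [mul_zero, pow_zero, pow_one]; rfl
    | succ k ih =>
      rw [pow_succ', mul_add, mul_one, pow_add, pow_mul, ← ih]
      rfl
  have hfp : f ^ p ^ 1 = 1 := by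
    funext x
    apply Subtype.ext
    rw [hf, pow_one, mul_assoc, mul_comm m, pow_two_pow_eq_self hK]
    rfl
  have htr (y : L) : traceSign N (suzukiTerm s l (y : K)) =
      traceSign (4 * m) (suzukiTerm s l y) := by
    have h1 : suzukiTerm s l (y : K) = (suzukiTerm s l y : L) := by simp [suzukiTerm]
    have h2 : (formalTrace (4 * m) ((suzukiTerm s l y : L) : K)) =
        (formalTrace (4 * m) (suzukiTerm s l y) : L) := by simp [formalTrace]
    unfold traceSign
    rw [h1, hN, show 4 * (p * m) = 4 * m * p by ring, formalTrace_mul ((hL _).1 (Subtype.prop _)),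
      h2]
    have hpK : (p : K) = 1 := by
      obtain ⟨c, hc⟩ := hp.odd_of_ne_two hp2
      rw [hc]
      simp [CharTwo.two_eq_zero]
    simp [hpK]
  have hfix : Fintype.card (Function.fixedPoints f) =
      Fintype.card {y : L // traceSign (4 * m) (suzukiTerm s l y) = 1} := by
    refine Fintype.card_congr
      { toFun := fun x ↦ ⟨⟨x.1.1, congrArg Subtype.val x.2⟩, ?_⟩
        invFun := fun y ↦ ⟨⟨y.1.1, by rw [htr, y.2]⟩, Subtype.ext y.1.2⟩
        left_inv := fun x ↦ rfl
        right_inv := fun y ↦ rfl }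
    rw [← htr]
    exact x.1.2
  have hmod := Equiv.Perm.card_fixedPoints_modEq hfp
  rw [hfix, ← Int.natCast_modEq_iff] at hmod
  have hmod' : ((2 ^ N : ℕ) : ℤ) ≡ ((2 ^ (4 * m) : ℕ) : ℤ) [ZMOD p] := by
    rw [← ZMod.intCast_eq_intCast_iff]
    push_cast
    rw [hN, show 4 * (p * m) = 4 * m * p by ring, pow_mul, ZMod.pow_card]
  rw [suzukiSum_eq_card, suzukiSum_eq_card, hK, hcard]
  exact (hmod.mul_left 2).sub hmod'

theorem suzukiSum_eq (s : ℕ) (n : ℕ) : ∀ (K : Type*) [Field K] [Fintype K] [CharP K 2],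
    n ∣ 2 * s + 1 → Fintype.card K = 2 ^ (4 * n) → suzukiSum K (4 * n) s (2 * s + 1) =
      jacobiSym 2 (2 * s + 1) * jacobiSym 2 n * 2 ^ ((5 * n + 1) / 2) := by
  induction n using Nat.strong_induction_on with
  | _ n ih =>
  intro K _ _ _ hn hK
  by_cases h1 : n = 1
  · subst h1
    rw [suzukiSum_of_card_eq_sixteen s hK, jacobiSym.one_right]
    norm_num
  obtain ⟨p, hp, m, rfl⟩ := Nat.exists_prime_and_dvd h1
  have := Fact.mk hp
  have hodd : Odd (p * m) := Odd.of_dvd_nat ⟨s, rfl⟩ hn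
  obtain ⟨hpo, hmo⟩ := Nat.odd_mul.1 hodd
  have hp2 : p ≠ 2 := by
    rintro rfl
    exact absurd hpo (by decide)
  have : NeZero m := ⟨hmo.pos.ne'⟩
  obtain ⟨L, _, hL, hmod⟩ := exists_subfield_suzukiSum_modEq (s := s) (l := 2 * s + 1) hp hp2 hK
  rw [ih m ((Nat.lt_mul_iff_one_lt_left hmo.pos).2 hp.one_lt) L
    ((Dvd.intro_left p rfl).trans hn) hL] at hmod
  have hexp : (5 * (p * m) + 1) / 2 = (5 * m + 1) / 2 + p / 2 * (5 * m) := by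
    obtain ⟨a, ha⟩ := hpo
    obtain ⟨b, hb⟩ := hmo
    have e1 : (5 * (p * m) + 1) / 2 = 10 * a * b + 5 * a + 5 * b + 3 := by
      rw [ha, hb, show 5 * ((2 * a + 1) * (2 * b + 1)) + 1 =
        2 * (10 * a * b + 5 * a + 5 * b + 3) by ring]
      omega
    rw [e1, show p / 2 = a by omega, show (5 * m + 1) / 2 = 5 * b + 3 by omega, hb]
    ring
  have hsgn {a : ℕ} (ha : Odd a) : jacobiSym 2 a = 1 ∨ jacobiSym 2 a = -1 := by
    refine jacobiSym.eq_one_or_neg_one ?_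
    rw [Int.gcd_comm]
    exact_mod_cast ha.coprime_two_right
  obtain ⟨δ, hδ, hS⟩ : ∃ δ : ℤ, (δ = 1 ∨ δ = -1) ∧
      suzukiSum K (4 * (p * m)) s (2 * s + 1) = δ * 2 ^ ((5 * (p * m) + 1) / 2) := by
    have hsq := suzukiSum_sq hn hK
    rw [show 5 * (p * m) + 1 = (5 * (p * m) + 1) / 2 * 2 by
      obtain ⟨b, hb⟩ := hodd
      omega, pow_mul] at hsq
    rcases sq_eq_sq_iff_eq_or_eq_neg.1 hsq with h | h
    · exact ⟨1, Or.inl rfl, by rw [h, one_mul]⟩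
    · exact ⟨-1, Or.inr rfl, by rw [h, neg_one_mul]⟩
  rw [hS] at hmod ⊢
  have hJ : ((2 : ℤ) : ZMod p) ^ (p / 2) = (jacobiSym 2 p : ℤ) := by
    rw [← jacobiSym.legendreSym.to_jacobiSym, legendreSym.eq_pow]
  have h20 : (2 : ZMod p) ≠ 0 := by
    intro h
    have := (ZMod.natCast_eq_zero_iff 2 p).1 (by exact_mod_cast h)
    exact hp2 ((Nat.prime_dvd_prime_iff_eq hp Nat.prime_two).1 this)
  have hJpow : (jacobiSym 2 p) ^ (5 * m) = jacobiSym 2 p := by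
    have : Odd (5 * m) := Nat.odd_mul.2 ⟨by decide, hmo⟩
    rcases hsgn hpo with h | h <;> simp [h, this.neg_one_pow]
  rw [← ZMod.intCast_eq_intCast_iff] at hmod
  have hkey : ((δ * jacobiSym 2 p : ℤ) : ZMod p) =
      ((jacobiSym 2 (2 * s + 1) * jacobiSym 2 m : ℤ) : ZMod p) := by
    apply mul_right_cancel₀ (pow_ne_zero ((5 * m + 1) / 2) h20)
    rw [hexp, pow_add, pow_mul 2 (p / 2)] at hmod
    push_cast at hmod hJ hJpow ⊢
    rw [hJ, ← Int.cast_pow, hJpow] at hmod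
    rw [← hmod]
    ring
  rw [jacobiSym.mul_right]
  congr 1
  have hne : (1 : ZMod p) ≠ -1 := by
    intro h
    apply h20
    linear_combination h
  have hJs := hsgn (a := 2 * s + 1) ⟨s, rfl⟩
  rcases hδ with h | h <;> rcases hsgn hpo with h' | h' <;> rcases hsgn hmo with h'' | h'' <;>
    rcases hJs with h3 | h3 <;> simp [h, h', h'', h3, hne, hne.symm] at hkey ⊢

theorem suzukiSum_self (s : ℕ) (hK : Fintype.card K = 2 ^ (4 * (2 * s + 1))) :
    suzukiSum K (4 * (2 * s + 1)) s (2 * s + 1) = 2 ^ (5 * s + 3) := by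
  rw [suzukiSum_eq s _ K dvd_rfl hK, ← pow_two, jacobiSym.sq_one (by simp [Int.gcd]), one_mul]
  congr 1
  omega

end SuzukiSum

/-- For `q_0 = 2^s`, `q = 2 q_0²`, and `F_{q⁴}` the field with `q⁴` elements, the number of
affine `F_{q⁴}`-rational points of the Suzuki curve `y^q + y = x^{q_0}(x^q + x)` is
`q⁴ + 2 q_0 q² (q − 1)`. -/
theorem suzuki_affine_points_over_Fq4 (s : ℕ) (hs : 0 < s) (q0 q : ℕ)
    (hq0 : q0 = 2 ^ s) (hq : q = 2 * q0 ^ 2)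
    (F : Type*) [Field F] [Fintype F] (hF : Fintype.card F = q ^ 4) :
    Nat.card {p : F × F // p.2 ^ q + p.2 = p.1 ^ q0 * (p.1 ^ q + p.1)}
      = q ^ 4 + 2 * q0 * q ^ 2 * (q - 1) := by
  classical
  have hql : q = 2 ^ (2 * s + 1) := by
    rw [hq, hq0]
    ring
  subst hq0
  have hK : Fintype.card F = 2 ^ (4 * (2 * s + 1)) := by
    rw [hF, hql, ← pow_mul, mul_comm]
  have : CharP F 2 := charP_of_card_eq_prime_pow hK
  rw [Nat.card_eq_fintype_card, Fintype.card_subtype]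
  rw [hql] at hq ⊢
  zify [Nat.one_le_two_pow (n := 2 * s + 1)]
  rw [card_suzuki_eq_sum (by omega) hK]
  have h0 : (0 : F) ∈ Finset.univ.filter fun t : F ↦ t ^ 2 ^ (2 * s + 1) = t := by simp
  have hcard := card_pow_two_pow_eq_self hK (2 * s + 1)
  rw [Nat.gcd_mul_left_left] at hcard
  rw [← Finset.add_sum_erase _ _ h0, Finset.sum_congr rfl fun t ht ↦
    sum_traceSign_mul_suzukiTerm (Finset.ne_of_mem_erase ht)
      (Finset.mem_filter.1 (Finset.mem_of_mem_erase ht)).2]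
  rw [Finset.sum_const, Finset.card_erase_of_mem h0, hcard, suzukiSum_self s hK]
  simp only [zero_mul, traceSign_zero, Finset.sum_const, Finset.card_univ, hK, nsmul_eq_mul]
  push_cast [Nat.one_le_two_pow]
  ring
end

section
/- Let s be a positive integer, q_0 = 2^s, q = 2·q_0², m = q − 2q_0 + 1, and let F_{q⁴} be the finite field with q⁴ elements. Suppose a, b ∈ F_{q⁴} satisfy b^q + b = a^{q_0}·(a^q + a) and a^q + a ≠ 0. Then the set {c ∈ F_{q⁴} : c^m = a^q + a} has exactly m = q − 2q_0 + 1 elements. -/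
/-- The Suzuki equation `f b + b = g a * (f a + a)`, with `f` of order dividing `4` and
`(g ∘ g) ^ 2 = f`, forces `w * f w * g w ^ 2` to be fixed by `f ∘ f`, where `w = f a + a`. -/
theorem suzuki_norm_fixed {F : Type*} [Field F] (h2 : (2 : F) = 0) (f g : F →+* F)
    (hf : ∀ x, f (f (f (f x))) = x) (hfg : ∀ x, f (g x) = g (f x))
    (hgg : ∀ x, g (g x) ^ 2 = f x) (a b : F) (hab : f b + b = g a * (f a + a)) :
    f (f ((f a + a) * f (f a + a) * g (f a + a) ^ 2)) =
      (f a + a) * f (f a + a) * g (f a + a) ^ 2 := by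
  have hab1 := congrArg f hab
  have hab2 := congrArg f hab1
  have hab3 := congrArg f hab2
  have linear : g (f a + a) * (f a + a) + g (f (f a) + f a) * (f (f a) + a)
      + g (f (f (f a)) + f (f a)) * (a + f (f (f a))) = 0 := by
    simp only [map_add, map_mul, hf, hfg] at hab hab1 hab2 hab3 ⊢
    linear_combination -hab - hab1 - hab2 - hab3 +
      (b + f b + f (f b) + f (f (f b)) + g (f a) * a + g (f (f a)) * a) * h2
  have quadratic : g (f a + a) ^ 2 * (f a + a) + g (f (f a) + f a) ^ 2 * (f (f a) + a)
      + g (f (f (f a)) + f (f a)) ^ 2 * (a + f (f (f a))) = 0 := by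
    have h := congrArg (fun x => g x ^ 2) linear
    simp only [map_add, map_mul, map_zero] at h ⊢
    have e0 := hgg a
    have e1 := hgg (f a)
    have e2 := hgg (f (f a))
    have e3 := hgg (f (f (f a)))
    rw [hf] at e3
    grind
  simp only [map_add, map_mul, map_pow, hf, hfg] at linear quadratic ⊢
  grind

/-- In a finite field, an element `w ≠ 0` with `w ^ ((#F - 1) / m) = 1` has exactly `m`
`m`-th roots. -/
theorem FiniteField.card_pow_eq {F : Type*} [Field F] [Fintype F] {m M : ℕ}
    (hmM : m * M = Fintype.card F - 1) {w : F} (hw : w ≠ 0) (hwM : w ^ M = 1) :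
    Nat.card {c : F // c ^ m = w} = m := by
  classical
  have hpos : 0 < m * M := by
    have := Fintype.one_lt_card (α := F)
    omega
  have hm : 0 < m := Nat.pos_of_mul_pos_right hpos
  have hM : 0 < M := Nat.pos_of_mul_pos_left hpos
  obtain ⟨g, hg⟩ := IsCyclic.exists_generator (α := Fˣ)
  have horder : orderOf g = m * M := by
    rw [orderOf_eq_card_of_forall_mem_zpowers hg, Nat.card_eq_fintype_card,
      Fintype.card_units, hmM]
  have hζ : IsPrimitiveRoot ((g : F) ^ M) m := by
    refine IsPrimitiveRoot.pow hpos ?_ (mul_comm m M)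
    rw [← horder, ← orderOf_units]
    exact IsPrimitiveRoot.orderOf _
  obtain ⟨k, hk⟩ := (mem_powers_iff_mem_zpowers.2 (hg (Units.mk0 w hw)))
  have hk' : (g : F) ^ k = w := by simpa using congrArg Units.val hk
  have hdvd : m ∣ k := by
    refine Nat.dvd_of_mul_dvd_mul_right hM ?_
    rw [← horder, ← orderOf_units]
    apply orderOf_dvd_of_pow_eq_one
    rw [pow_mul, hk', hwM]
  obtain ⟨j, rfl⟩ := hdvd
  have hex : ∃ c : F, c ^ m = w := ⟨(g : F) ^ j, by rw [← pow_mul, mul_comm, hk']⟩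
  have hcard := hζ.card_nthRoots w
  rw [if_pos hex, ← Multiset.toFinset_card_of_nodup (hζ.nthRoots_nodup hw)] at hcard
  rw [Nat.card_eq_fintype_card, Fintype.card_of_subtype (Polynomial.nthRoots m w).toFinset
    fun c => by simp [Polynomial.mem_nthRoots hm], hcard]


/-- For `q_0 = 2^s`, `q = 2 q_0²`, `m = q − 2q_0 + 1`, and `F_{q⁴}` the field with `q⁴`
elements: if `a, b ∈ F_{q⁴}` satisfy the Suzuki equation `b^q + b = a^{q_0}(a^q + a)` and
`a^q + a ≠ 0`, then the equation `c^m = a^q + a` has exactly `m` solutions `c ∈ F_{q⁴}`. -/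
theorem suzuki_fiber_card (s : ℕ) (hs : 0 < s) (q0 q m : ℕ)
    (hq0 : q0 = 2 ^ s) (hq : q = 2 * q0 ^ 2) (hm : m = q - 2 * q0 + 1)
    (F : Type*) [Field F] [Fintype F] (hF : Fintype.card F = q ^ 4)
    (a b : F) (hab : b ^ q + b = a ^ q0 * (a ^ q + a)) (ha : a ^ q + a ≠ 0) :
    Nat.card {c : F // c ^ m = a ^ q + a} = m := by
  have hcard : Fintype.card F = 2 ^ ((2 * s + 1) * 4) := by
    rw [hF, hq, hq0]; ring
  have : CharP F 2 := charP_of_card_eq_prime_pow hcard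
  have : ExpChar F 2 := ExpChar.prime Nat.prime_two
  have hq2 : q = 2 ^ (2 * s + 1) := by rw [hq, hq0]; ring
  have hf (x : F) : iterateFrobenius F 2 (2 * s + 1) x = x ^ q := by
    rw [iterateFrobenius_def, hq2]
  have hg (x : F) : iterateFrobenius F 2 s x = x ^ q0 := by
    rw [iterateFrobenius_def, hq0]
  have key := suzuki_norm_fixed (CharTwo.two_eq_zero (R := F))
    (iterateFrobenius F 2 (2 * s + 1)) (iterateFrobenius F 2 s)
    (fun x => by
      simp only [hf, ← pow_mul]
      rw [show q * q * q * q = Fintype.card F by rw [hF]; ring, FiniteField.pow_card])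
    (fun x => by rw [hg, hg, map_pow])
    (fun x => by simp only [hf, hg, ← pow_mul]; rw [hq]; ring)
    a b (by simpa only [hf, hg] using hab)
  simp only [hf, hg] at key
  have hq0q : 2 * q0 ≤ q := by
    have : 0 < q0 := by rw [hq0]; positivity
    rw [hq]; nlinarith
  have hqpos : 1 ≤ q ^ 2 := Nat.one_le_pow _ _ (by rw [hq2]; positivity)
  have hmN : m * (q + 2 * q0 + 1) = q ^ 2 + 1 := by
    obtain ⟨d, hd⟩ := Nat.exists_eq_add_of_le hq0q
    have hm' : m = d + 1 := by omega
    rw [hm']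
    nlinarith
  generalize a ^ q + a = w at *
  have hw : w * w ^ q * (w ^ q0) ^ 2 = w ^ (q + 2 * q0 + 1) := by ring
  rw [hw, ← pow_mul, ← pow_two] at key
  refine FiniteField.card_pow_eq (M := (q + 2 * q0 + 1) * (q ^ 2 - 1)) ?_ ha ?_
  · rw [hF, ← mul_assoc, hmN]
    obtain ⟨d, hd⟩ := Nat.exists_eq_add_of_le hqpos
    rw [show q ^ 4 = (q ^ 2) ^ 2 by ring, hd, Nat.add_sub_cancel_left]
    have : (1 + d) ^ 2 = (1 + d + 1) * d + 1 := by ring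
    omega
  · rw [pow_mul]
    refine mul_right_cancel₀ (pow_ne_zero (q + 2 * q0 + 1) ha) ?_
    rw [one_mul, ← pow_succ, Nat.sub_add_cancel hqpos]
    exact key
end

section
/- Let s be a positive integer, q_0 = 2^s, q = 2·q_0², m = q − 2q_0 + 1, and let F_{q⁴} be the finite field with q⁴ elements. Then the number of triples (a,b,c) ∈ F_{q⁴}³ satisfying b^q + b = a^{q_0}·(a^q + a), c^m = a^q + a, and c ≠ 0 equals q⁵ − q⁴ + q³ − q², which also equals (q − 2q_0 + 1)·(q⁴ + 2q_0q²(q − 1) − q²). -/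
namespace SuzukiCount

section PowersInFiniteFields

variable {F : Type*} [Field F] [Fintype F]

lemma card_units_pow_eq_one (d : ℕ) :
    Nat.card {x : Fˣ // x ^ d = 1} = (Fintype.card F - 1).gcd d := by
  have h := IsCyclic.card_powMonoidHom_ker (G := Fˣ) d
  rw [Nat.card_units, Nat.card_eq_fintype_card (α := F)] at h
  exact h

lemma card_pow_eq_of_ne_zero {d : ℕ} (hd : d ∣ Fintype.card F - 1) (hd0 : 0 < d) {u : F}
    (hu : u ≠ 0) (hpow : u ^ ((Fintype.card F - 1) / d) = 1) :
    Nat.card {c : F // c ^ d = u ∧ c ≠ 0} = d := by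
  have hcard : Nat.card Fˣ = Fintype.card F - 1 := by
    rw [Nat.card_units, Nat.card_eq_fintype_card]
  have hpos : 0 < Fintype.card F - 1 := Nat.sub_pos_of_lt Fintype.one_lt_card
  obtain ⟨c₀, hc₀⟩ : ∃ c₀ : Fˣ, c₀ ^ d = Units.mk0 u hu := by
    obtain ⟨g, hg⟩ := IsCyclic.exists_generator (α := Fˣ)
    obtain ⟨k, hk⟩ := (Submonoid.mem_powers_iff _ _).1
      (mem_powers_iff_mem_zpowers.2 (hg (Units.mk0 u hu)))
    have hord : orderOf g = Fintype.card F - 1 := by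
      rw [orderOf_eq_card_of_forall_mem_zpowers hg, hcard]
    have h1 : g ^ (k * ((Fintype.card F - 1) / d)) = 1 := by
      rw [pow_mul, hk]
      ext
      simpa using hpow
    have h2 := orderOf_dvd_of_pow_eq_one h1
    obtain ⟨e, he⟩ := hd
    rw [hord, he, Nat.mul_div_cancel_left _ hd0] at h2
    have he0 : 0 < e := by
      rcases Nat.eq_zero_or_pos e with rfl | h
      · simp at he; omega
      · exact h
    obtain ⟨j, rfl⟩ := Nat.dvd_of_mul_dvd_mul_right he0 h2
    exact ⟨g ^ j, by rw [← hk, ← pow_mul, mul_comm]⟩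
  have hc₀' : (c₀ : F) ^ d = u := by
    simpa using congrArg (Units.val) hc₀
  have := card_units_pow_eq_one (F := F) d
  rw [Nat.gcd_eq_right hd] at this
  have e : {c : F // c ^ d = u ∧ c ≠ 0} ≃ {x : Fˣ // x ^ d = 1} :=
    { toFun := fun c => ⟨Units.mk0 c.1 c.2.2 * c₀⁻¹, by
        rw [mul_pow, inv_pow, hc₀, mul_inv_eq_one]
        ext
        simpa using c.2.1⟩
      invFun := fun x => ⟨x.1 * c₀, by
        have := congrArg Units.val x.2
        push_cast at this
        rw [mul_pow, hc₀', this, one_mul], by simp⟩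
      left_inv := fun c => by simp
      right_inv := fun x => by ext; simp }
  exact (Nat.card_congr e).trans this

omit [Fintype F] in
lemma pow_two_pow_eq_self_iff {x : F} (hx : x ≠ 0) (k : ℕ) :
    x ^ 2 ^ k = x ↔ x ^ (2 ^ k - 1) = 1 := by
  conv_lhs => lhs; rw [← Nat.sub_add_cancel (Nat.one_le_two_pow (n := k)), pow_succ]
  rw [mul_eq_right₀ hx]

lemma card_pow_two_pow_eq_self {N : ℕ} (hF : Fintype.card F = 2 ^ N) (k : ℕ) :
    Nat.card {x : F // x ^ 2 ^ k = x} = 2 ^ k.gcd N := by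
  have h := card_units_pow_eq_one (F := F) (2 ^ k - 1)
  rw [hF, Nat.pow_sub_one_gcd_pow_sub_one, Nat.gcd_comm] at h
  have e : {x : F // x ^ 2 ^ k = x} ≃ Option {x : Fˣ // x ^ (2 ^ k - 1) = 1} := by
    classical
    exact
    { toFun := fun x => if hx : x.1 = 0 then none else
        some ⟨Units.mk0 x.1 hx, by
          ext
          simpa using (pow_two_pow_eq_self_iff hx k).1 x.2⟩
      invFun := fun y => y.elim ⟨0, by simp⟩ fun z => ⟨z.1, by
          rw [pow_two_pow_eq_self_iff z.1.ne_zero]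
          simpa using congrArg Units.val z.2⟩
      left_inv := fun x => by
        by_cases hx : x.1 = 0
        · ext; simp [hx]
        · simp [hx]
      right_inv := fun y => by
        cases y <;> simp }
  rw [Nat.card_congr e, Finite.card_option, h, Nat.sub_add_cancel Nat.one_le_two_pow]

lemma exists_fifth_root {n : ℕ} (hF : Fintype.card F = 2 ^ (4 * n)) :
    ∃ z : F, z ^ 4 + z ^ 3 + z ^ 2 + z + 1 = 0 := by
  have : Fact (Nat.Prime 5) := ⟨by norm_num⟩
  have hdvd : 5 ∣ Nat.card Fˣ := by
    rw [Nat.card_units, Nat.card_eq_fintype_card, hF, pow_mul]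
    have : (2 ^ 4) ^ n ≡ 1 ^ n [MOD 5] := Nat.ModEq.pow n (by decide)
    rw [one_pow] at this
    exact (Nat.modEq_iff_dvd' (Nat.one_le_pow _ _ (by norm_num))).1 this.symm
  obtain ⟨z, hz⟩ := exists_prime_orderOf_dvd_card' 5 hdvd
  have hz1 : (z : F) ≠ 1 := by
    intro h
    have : z = 1 := Units.ext h
    simp [this] at hz
  have hz5 : (z : F) ^ 5 = 1 := by
    have := pow_orderOf_eq_one z
    rw [hz] at this
    simpa using congrArg Units.val this
  refine ⟨z, mul_left_cancel₀ (sub_ne_zero.2 hz1) ?_⟩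
  linear_combination hz5

end PowersInFiniteFields

section SignCharacters

variable {F : Type*} [Field F] [CharP F 2]

lemma add_pow_two_pow (x y : F) (k : ℕ) : (x + y) ^ 2 ^ k = x ^ 2 ^ k + y ^ 2 ^ k :=
  add_pow_char_pow ..

lemma exists_frobenius_invariant_addChar (F : Type*) [Field F] [Finite F] [CharP F 2] :
    ∃ ψ : AddChar F ℤ, (∀ x, ψ (x ^ 2) = ψ x) ∧ ψ ≠ 1 := by
  let := ZMod.algebra F 2
  have h2 : ((-1 : ℤ)) ^ 2 = 1 := by norm_num
  let χ : AddChar (ZMod 2) ℤ := AddChar.zmodChar 2 h2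
  refine ⟨χ.compAddMonoidHom (Algebra.trace (ZMod 2) F).toAddMonoidHom, fun x => ?_, ?_⟩
  · have : Algebra.trace (ZMod 2) F (x ^ 2) = Algebra.trace (ZMod 2) F x := by
      have h := Algebra.trace_eq_of_algEquiv
        (FiniteField.frobeniusAlgEquivOfAlgebraic (ZMod 2) F) x
      simpa using h
    simp [this]
  · obtain ⟨x, hx⟩ := Algebra.trace_surjective (ZMod 2) F 1
    rw [AddChar.ne_one_iff]
    refine ⟨x, ?_⟩
    simp [hx, χ, AddChar.zmodChar_apply, ZMod.val_one]

variable {ψ : AddChar F ℤ}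

lemma addChar_mul_self (ψ : AddChar F ℤ) (x : F) : ψ x * ψ x = 1 := by
  rw [← AddChar.map_add_eq_mul, CharTwo.add_self_eq_zero, AddChar.map_zero_eq_one]

lemma addChar_eq_one_or (ψ : AddChar F ℤ) (x : F) : ψ x = 1 ∨ ψ x = -1 :=
  mul_self_eq_one_iff.1 (addChar_mul_self ψ x)

omit [CharP F 2] in
lemma addChar_pow_two_pow (hψ : ∀ x, ψ (x ^ 2) = ψ x) (x : F) (k : ℕ) : ψ (x ^ 2 ^ k) = ψ x := by
  induction k with
  | zero => simp
  | succ k ih => rw [pow_succ, pow_mul, hψ, ih]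

end SignCharacters

section QuadraticSum

variable {F : Type*} [Field F]

/-- The function `a ↦ a^{2^s} (a^{2^{2s+1}} + a)`, i.e. `a^{q₀} (a^q + a)`. -/
def suzukiForm (s : ℕ) (a : F) : F := a ^ 2 ^ s * (a ^ 2 ^ (2 * s + 1) + a)

variable [CharP F 2] {ψ : AddChar F ℤ}

lemma addChar_suzukiForm_add (hψ : ∀ x, ψ (x ^ 2) = ψ x) (s : ℕ) (a h : F) :
    ψ (suzukiForm s (a + h)) * ψ (suzukiForm s a) = ψ (suzukiForm s h) *
      ψ (a ^ 2 ^ (3 * s + 1) *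
        ((h ^ 2 ^ (2 * s + 1) + h) ^ 2 ^ (2 * s) +
          ((h ^ 2 ^ (2 * s + 1) + h) ^ 2 ^ (2 * s)) ^ 2)) := by
  have key : suzukiForm s (a + h) + suzukiForm s a + suzukiForm s h =
      h ^ 2 ^ s * a ^ 2 ^ (2 * s + 1) + h ^ 2 ^ s * a
        + (a ^ 2 ^ s * h ^ 2 ^ (2 * s + 1) + a ^ 2 ^ s * h) := by
    simp only [suzukiForm, add_pow_two_pow]
    linear_combination (a ^ 2 ^ s * (a ^ 2 ^ (2 * s + 1) + a)
      + h ^ 2 ^ s * (h ^ 2 ^ (2 * s + 1) + h)) * CharTwo.two_eq_zero (R := F)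
  have e1 : ψ (h ^ 2 ^ s * a ^ 2 ^ (2 * s + 1)) = ψ (h ^ 2 ^ (2 * s) * a ^ 2 ^ (3 * s + 1)) := by
    rw [← addChar_pow_two_pow hψ _ s, mul_pow, ← pow_mul, ← pow_mul, ← pow_add, ← pow_add]
    ring_nf
  have e2 : ψ (h ^ 2 ^ s * a) = ψ (h ^ 2 ^ (4 * s + 1) * a ^ 2 ^ (3 * s + 1)) := by
    rw [← addChar_pow_two_pow hψ _ (3 * s + 1), mul_pow, ← pow_mul, ← pow_add]
    ring_nf
  have e3 : ψ (a ^ 2 ^ s * h ^ 2 ^ (2 * s + 1)) =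
      ψ (h ^ 2 ^ (4 * s + 2) * a ^ 2 ^ (3 * s + 1)) := by
    rw [← addChar_pow_two_pow hψ _ (2 * s + 1), mul_pow, ← pow_mul, ← pow_mul, ← pow_add,
      ← pow_add]
    ring_nf
  have e4 : ψ (a ^ 2 ^ s * h) = ψ (h ^ 2 ^ (2 * s + 1) * a ^ 2 ^ (3 * s + 1)) := by
    rw [← addChar_pow_two_pow hψ _ (2 * s + 1), mul_pow, ← pow_mul, ← pow_add]
    ring_nf
  have hB := congrArg ψ key
  simp only [AddChar.map_add_eq_mul] at hB
  rw [e1, e2, e3, e4] at hB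
  simp only [← AddChar.map_add_eq_mul] at hB
  have expand : h ^ 2 ^ (2 * s) * a ^ 2 ^ (3 * s + 1) + h ^ 2 ^ (4 * s + 1) * a ^ 2 ^ (3 * s + 1)
      + (h ^ 2 ^ (4 * s + 2) * a ^ 2 ^ (3 * s + 1) + h ^ 2 ^ (2 * s + 1) * a ^ 2 ^ (3 * s + 1))
      = a ^ 2 ^ (3 * s + 1) * ((h ^ 2 ^ (2 * s + 1) + h) ^ 2 ^ (2 * s) +
          ((h ^ 2 ^ (2 * s + 1) + h) ^ 2 ^ (2 * s)) ^ 2) := by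
    rw [add_pow_two_pow, CharTwo.add_sq, ← pow_mul, ← pow_mul, ← pow_mul, ← pow_add, ← pow_succ,
      ← pow_succ]
    ring_nf
  rw [expand] at hB
  rw [← hB, AddChar.map_add_eq_mul, AddChar.map_add_eq_mul]
  linear_combination (-ψ (suzukiForm s (a + h)) * ψ (suzukiForm s a))
    * addChar_mul_self ψ (suzukiForm s h)

variable [Fintype F]

lemma sum_addChar_pow_mul [DecidableEq F] (hψ1 : ψ ≠ 1) (k : ℕ) (w : F) :
    ∑ a, ψ (a ^ 2 ^ k * w) = if w = 0 then (Fintype.card F : ℤ) else 0 := by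
  have hbij : Function.Bijective (iterateFrobenius F 2 k) :=
    Finite.injective_iff_bijective.1 (iterateFrobenius F 2 k).injective
  refine (hbij.sum_comp fun x => ψ (x * w)).trans ?_
  rw [AddChar.sum_mulShift w (AddChar.IsPrimitive.of_ne_one hψ1)]
  split_ifs <;> simp

/-- A primitive cube root of unity that is a value of `z ↦ z^4 + z`. -/
lemma exists_cube_root {n : ℕ} (hF : Fintype.card F = 2 ^ (4 * n)) :
    ∃ w : F, w ^ 2 = w + 1 ∧ ∀ ψ : AddChar F ℤ, (∀ x, ψ (x ^ 2) = ψ x) → ψ w = 1 := by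
  obtain ⟨z, hz⟩ := exists_fifth_root hF
  have h2 := CharTwo.two_eq_zero (R := F)
  refine ⟨z + z ^ 4, ?_, fun ψ hψ => ?_⟩
  · linear_combination (z ^ 4 - z ^ 3 + 1) * hz + (z ^ 5 - z - 1 - z ^ 4) * h2
  · rw [AddChar.map_add_eq_mul, show (4 : ℕ) = 2 ^ 2 by norm_num, addChar_pow_two_pow hψ,
      addChar_mul_self]

omit [Fintype F] in
lemma cube_root_pow {w : F} (hw : w ^ 2 = w + 1) (k : ℕ) : w ^ 2 ^ (2 * k + 1) = w + 1 := by
  have h4 : w ^ 4 = w := by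
    linear_combination (w ^ 2 + w + 2) * hw + (w + 1) * CharTwo.two_eq_zero (R := F)
  induction k with
  | zero => simpa using hw
  | succ k ih =>
    rw [show 2 * (k + 1) + 1 = 2 * k + 1 + 2 by ring, pow_add 2, pow_mul, ih]
    rw [add_pow_two_pow]
    simp [h4]

lemma addChar_suzukiForm_of_radical (hψ : ∀ x, ψ (x ^ 2) = ψ x) {n : ℕ}
    (hF : Fintype.card F = 2 ^ (4 * n)) {s : ℕ} {h : F}
    (hh : h ^ 2 ^ (2 * s + 1) + h = 0 ∨ h ^ 2 ^ (2 * s + 1) + h = 1) :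
    ψ (suzukiForm s h) = 1 := by
  rcases hh with hh | hh
  · simp [suzukiForm, hh]
  · obtain ⟨w, hw, hw1⟩ := exists_cube_root hF
    have h2 := CharTwo.two_eq_zero (R := F)
    have hdec : h = (w * h) ^ 2 ^ (2 * s + 1) + w * h + w ^ 2 := by
      rw [mul_pow, cube_root_pow hw]
      linear_combination (-w - 1) * hh - hw + (h - w - 1) * h2
    rw [suzukiForm, hh, mul_one, addChar_pow_two_pow hψ, hdec, AddChar.map_add_eq_mul,
      AddChar.map_add_eq_mul, addChar_pow_two_pow hψ, addChar_mul_self, hψ, hw1 ψ hψ, one_mul]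

lemma card_radical {n s : ℕ} (hn : n ∣ 2 * s + 1) (hF : Fintype.card F = 2 ^ (4 * n)) :
    Nat.card {h : F // h ^ 2 ^ (2 * s + 1) + h = 0 ∨ h ^ 2 ^ (2 * s + 1) + h = 1} =
      2 ^ (n + 1) := by
  classical
  obtain ⟨w, hw, -⟩ := exists_cube_root hF
  have h2 := CharTwo.two_eq_zero (R := F)
  have h0 : Nat.card {h : F // h ^ 2 ^ (2 * s + 1) + h = 0} = 2 ^ n := by
    have hgcd : (2 * s + 1).gcd (4 * n) = n := by
      have hc : (2 * s + 1).Coprime 4 :=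
        Nat.Coprime.pow_right 2 (Nat.coprime_two_right.2 ⟨s, rfl⟩)
      rw [hc.symm.gcd_mul_left_cancel_right, Nat.gcd_eq_right hn]
    rw [← hgcd, ← card_pow_two_pow_eq_self hF]
    simp only [CharTwo.add_eq_zero]
  have h1 : Nat.card {h : F // h ^ 2 ^ (2 * s + 1) + h = 1} = 2 ^ n := by
    rw [← h0]
    refine Nat.card_congr ((Equiv.addRight w).subtypeEquiv fun h => ?_)
    rw [Equiv.coe_addRight, add_pow_two_pow, cube_root_pow hw, ← CharTwo.add_eq_zero]
    refine Eq.congr ?_ rfl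
    linear_combination -w * h2
  have hdis : Disjoint (fun h : F => h ^ 2 ^ (2 * s + 1) + h = 0)
      (fun h : F => h ^ 2 ^ (2 * s + 1) + h = 1) := by
    rw [Pi.disjoint_iff]
    intro h
    simp only [Prop.disjoint_iff]
    rintro ⟨ha, hb⟩
    exact zero_ne_one (ha.symm.trans hb)
  rw [Nat.card_congr (subtypeOrEquiv _ _ hdis), Nat.card_sum, h0, h1]
  ring

lemma sum_suzukiForm_sq (hψ : ∀ x, ψ (x ^ 2) = ψ x) (hψ1 : ψ ≠ 1) {n s : ℕ}
    (hn : n ∣ 2 * s + 1) (hF : Fintype.card F = 2 ^ (4 * n)) :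
    (∑ a : F, ψ (suzukiForm s a)) ^ 2 = 2 ^ (5 * n + 1) := by
  classical
  have hrad : ∀ h : F, ((h ^ 2 ^ (2 * s + 1) + h) ^ 2 ^ (2 * s) +
      ((h ^ 2 ^ (2 * s + 1) + h) ^ 2 ^ (2 * s)) ^ 2 = 0) ↔
      (h ^ 2 ^ (2 * s + 1) + h = 0 ∨ h ^ 2 ^ (2 * s + 1) + h = 1) := by
    intro h
    set v := h ^ 2 ^ (2 * s + 1) + h
    have hinj := (iterateFrobenius F 2 (2 * s)).injective
    have h1 : v ^ 2 ^ (2 * s) = 1 ↔ v = 1 := by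
      constructor
      · intro hv
        exact hinj (by simpa [iterateFrobenius_def] using hv)
      · rintro hv; simp [hv]
    rw [show v ^ 2 ^ (2 * s) + (v ^ 2 ^ (2 * s)) ^ 2
      = v ^ 2 ^ (2 * s) * (v ^ 2 ^ (2 * s) + 1) by ring, mul_eq_zero, CharTwo.add_eq_zero, h1,
      pow_eq_zero_iff (by positivity)]
  calc (∑ a : F, ψ (suzukiForm s a)) ^ 2
      = ∑ a : F, ∑ h : F, ψ (suzukiForm s (a + h)) * ψ (suzukiForm s a) := by
        rw [sq, Finset.sum_mul_sum, Finset.sum_comm]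
        refine Finset.sum_congr rfl fun a _ => ?_
        exact (Equiv.sum_comp (Equiv.addLeft a)
          fun b => ψ (suzukiForm s b) * ψ (suzukiForm s a)).symm
    _ = ∑ h : F, if h ^ 2 ^ (2 * s + 1) + h = 0 ∨ h ^ 2 ^ (2 * s + 1) + h = 1 then
          (Fintype.card F : ℤ) else 0 := by
        rw [Finset.sum_comm]
        refine Finset.sum_congr rfl fun h _ => ?_
        simp only [addChar_suzukiForm_add hψ, ← Finset.mul_sum]
        rw [sum_addChar_pow_mul hψ1]
        simp only [hrad]
        split_ifs with hh
        · rw [addChar_suzukiForm_of_radical hψ hF hh, one_mul]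
        · simp
    _ = 2 ^ (5 * n + 1) := by
        rw [← Finset.sum_filter, Finset.sum_const, ← Fintype.card_subtype,
          ← Nat.card_eq_fintype_card, card_radical hn hF, hF]
        push_cast
        rw [nsmul_eq_mul]
        push_cast
        ring

end QuadraticSum

section SignOfTheSum

lemma sum_modEq_sum_fixedPoints {α : Type*} [Fintype α] [DecidableEq α] {p : ℕ} [Fact p.Prime]
    (σ : α → α) (hσ : σ^[p] = id) (g : α → ℤ) (hg : ∀ x, g (σ x) = g x) :
    ∑ x, g x ≡ ∑ x with σ x = x, g x [ZMOD p] := by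
  rw [← Finset.sum_fiberwise_of_maps_to (s := Finset.univ) (t := Finset.univ.image g) (g := g)
      (fun x _ => Finset.mem_image_of_mem g (Finset.mem_univ x)),
    ← Finset.sum_fiberwise_of_maps_to (s := {x | σ x = x}) (t := Finset.univ.image g) (g := g)
      (fun x _ => Finset.mem_image_of_mem g (Finset.mem_univ x))]
  refine Int.ModEq.sum fun v _ => ?_
  have hconst : ∀ s : Finset α, ∑ x ∈ s with g x = v, g x = (s.filter (g · = v)).card * v := by
    intro s
    rw [Finset.sum_congr rfl fun x hx => (Finset.mem_filter.1 hx).2, Finset.sum_const,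
      nsmul_eq_mul]
  rw [hconst, hconst]
  refine Int.ModEq.mul_right _ (Int.natCast_modEq_iff.2 ?_)
  let f : Function.End {x // g x = v} := fun x => ⟨σ x.1, (hg x.1).trans x.2⟩
  have hval : ∀ (k : ℕ) (x : {x // g x = v}), ((f^[k]) x).1 = σ^[k] x.1 := by
    intro k
    induction k with
    | zero => intro x; rfl
    | succ k ih => intro x; rw [Function.iterate_succ_apply, Function.iterate_succ_apply, ih]
  have hf : f ^ p ^ 1 = 1 := by
    rw [pow_one]
    funext x
    refine Subtype.ext ?_
    have : (f ^ p) x = f^[p] x := congrFun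
      (hom_coe_pow (fun g : Function.End _ => (g : _ → _)) rfl (fun _ _ => rfl) f p) x
    rw [this, hval, hσ]
    rfl
  have hmod := Equiv.Perm.card_fixedPoints_modEq hf
  rw [← Fintype.card_subtype]
  refine hmod.trans (congrArg (· % p) ?_)
  rw [Finset.filter_filter, ← Fintype.card_subtype]
  refine Fintype.card_congr
    { toFun := fun x => ⟨x.1.1, congrArg Subtype.val x.2, x.1.2⟩
      invFun := fun x => ⟨⟨x.1, x.2.2⟩, Subtype.ext x.2.1⟩
      left_inv := fun x => rfl
      right_inv := fun x => rfl }

variable {F : Type*} [Field F] [CharP F 2] [Fintype F] {ψ : AddChar F ℤ}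

lemma addChar_eq_one_of_pow_four (hψ : ∀ x, ψ (x ^ 2) = ψ x) {n : ℕ}
    (hF : Fintype.card F = 2 ^ (4 * n)) {b : F} (hb : b ^ 4 = b) : ψ b = 1 := by
  obtain ⟨w, hw, hw1⟩ := exists_cube_root hF
  have h2 := CharTwo.two_eq_zero (R := F)
  have hww : ψ (w + 1) = 1 := by rw [← hw, hψ, hw1 ψ hψ]
  have hone : ψ 1 = 1 := by
    rw [AddChar.map_add_eq_mul, hw1 ψ hψ, one_mul] at hww
    exact hww
  have hfac : b * ((b + 1) * ((b + w) * (b + (w + 1)))) = 0 := by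
    linear_combination hb + b * (b + 1) * hw + (b ^ 3 + b ^ 2 + b ^ 3 * w + 2 * b ^ 2 * w
      + b * w + b) * h2
  rcases mul_eq_zero.1 hfac with h | h
  · rw [h, AddChar.map_zero_eq_one]
  rcases mul_eq_zero.1 h with h | h
  · rw [CharTwo.add_eq_zero.1 h, hone]
  rcases mul_eq_zero.1 h with h | h
  · rw [CharTwo.add_eq_zero.1 h, hw1 ψ hψ]
  · rw [CharTwo.add_eq_zero.1 h, hww]

lemma sum_suzukiForm_eq_or (hψ : ∀ x, ψ (x ^ 2) = ψ x) (hψ1 : ψ ≠ 1) {n s : ℕ}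
    (hn : n ∣ 2 * s + 1) (hF : Fintype.card F = 2 ^ (4 * n)) :
    ∑ a : F, ψ (suzukiForm s a) = 2 ^ ((5 * n + 1) / 2) ∨
      ∑ a : F, ψ (suzukiForm s a) = -2 ^ ((5 * n + 1) / 2) := by
  have hodd : Odd n := Odd.of_dvd_nat ⟨s, rfl⟩ hn
  rw [← sq_eq_sq_iff_eq_or_eq_neg, sum_suzukiForm_sq hψ hψ1 hn hF, ← pow_mul,
    Nat.div_mul_cancel]
  obtain ⟨k, rfl⟩ := hodd
  exact ⟨5 * k + 3, by ring⟩

lemma sum_addChar_cube (hF : Fintype.card F = 2 ^ (4 * 1)) :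
    ∑ a : F, ψ (a ^ 3) ≡ 1 [ZMOD 3] := by
  classical
  obtain ⟨w, hw, -⟩ := exists_cube_root hF
  have h2 := CharTwo.two_eq_zero (R := F)
  have hw3 : w ^ 3 = 1 := by linear_combination (w + 1) * hw + w * h2
  have hw1 : w ≠ 1 := by
    rintro rfl
    simp at hw
  have : Fact (Nat.Prime 3) := ⟨Nat.prime_three⟩
  have hmod := sum_modEq_sum_fixedPoints (p := 3) (fun a : F => w * a)
    (by funext a; simp only [Function.iterate_succ, Function.iterate_zero, Function.comp, id]
        linear_combination a * hw3)
    (fun a => ψ (a ^ 3)) (fun a => by simp only [mul_pow, hw3, one_mul])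
  have hfix : ({a : F | w * a = a} : Finset F) = {0} := by
    ext a
    simp only [Finset.mem_filter, Finset.mem_univ, true_and, Finset.mem_singleton]
    refine ⟨fun h => ?_, fun h => by rw [h, mul_zero]⟩
    by_contra ha
    exact hw1 (mul_eq_right₀ ha |>.1 h)
  rw [hfix] at hmod
  simpa using hmod

lemma sum_addChar_cube_mul (hψ : ∀ x, ψ (x ^ 2) = ψ x) (hF : Fintype.card F = 2 ^ (4 * 1)) :
    -8 < ∑ a : F, ψ (a ^ 3) * ψ a := by
  classical
  obtain ⟨z, hz⟩ := exists_fifth_root hF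
  have hz5 : z ^ 5 = 1 := by linear_combination (z - 1) * hz
  have hzne : z ^ 4 ≠ z := by
    intro h
    have hz2 : z ^ 2 = 1 := by linear_combination hz5 - z * h
    have hz1 : z = 1 := by linear_combination (z ^ 2 + 1) * hz2 - h
    rw [hz1] at hz
    have h2 := CharTwo.two_eq_zero (R := F)
    refine one_ne_zero (α := F) ?_
    linear_combination hz - 2 * h2
  set A : Finset F := {a | ψ (a ^ 3) * ψ a = 1} with hA
  have hsub : insert z ({b | b ^ 4 = b} : Finset F) ⊆ A := by
    intro b hb
    rw [hA, Finset.mem_filter]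
    refine ⟨Finset.mem_univ _, ?_⟩
    rcases Finset.mem_insert.1 hb with rfl | hb
    · have : ψ (b ^ 3) = ψ b := by
        rw [← addChar_pow_two_pow hψ b 3]
        congr 1
        linear_combination (-b ^ 3) * hz5
      rw [this, addChar_mul_self]
    · have hb4 : b ^ 4 = b := (Finset.mem_filter.1 hb).2
      rw [addChar_eq_one_of_pow_four hψ hF hb4, mul_one]
      exact addChar_eq_one_of_pow_four hψ hF (by rw [← pow_mul, mul_comm, pow_mul, hb4])
  have hcard : 5 ≤ A.card := by
    refine le_trans ?_ (Finset.card_le_card hsub)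
    have h4 := card_pow_two_pow_eq_self hF 2
    rw [Nat.card_eq_fintype_card, Fintype.card_subtype] at h4
    norm_num at h4
    rw [Finset.card_insert_of_notMem (by simpa using hzne), h4]
  have hsum : ∑ a : F, ψ (a ^ 3) * ψ a =
      ∑ a : F, (2 * (if ψ (a ^ 3) * ψ a = 1 then 1 else 0) - 1) := by
    refine Finset.sum_congr rfl fun a _ => ?_
    rw [← AddChar.map_add_eq_mul]
    rcases addChar_eq_one_or ψ (a ^ 3 + a) with h | h <;> simp [h]
  rw [hsum, Finset.sum_sub_distrib, ← Finset.mul_sum, Finset.sum_boole]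
  simp only [Finset.sum_const, Finset.card_univ, hF, ← hA]
  norm_num
  omega

omit [CharP F 2] [Fintype F] in
lemma pow_two_pow_add_of_pow_sixteen {a : F} (ha : a ^ 16 = a) (k r : ℕ) :
    a ^ 2 ^ (4 * k + r) = a ^ 2 ^ r := by
  have : a ^ 2 ^ (4 * k) = a := by
    induction k with
    | zero => simp
    | succ k ih => rw [mul_add, pow_add, pow_mul, ih]; simpa using ha
  rw [pow_add, pow_mul, this]

lemma sum_suzukiForm_sixteen (hψ : ∀ x, ψ (x ^ 2) = ψ x) (hψ1 : ψ ≠ 1)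
    (hF : Fintype.card F = 2 ^ (4 * 1)) (s : ℕ) :
    ∑ a : F, ψ (suzukiForm s a) = ZMod.χ₈ ((2 * s + 1 : ℕ) : ZMod 8) * 2 ^ 3 := by
  have hpm := sum_suzukiForm_eq_or hψ hψ1 (one_dvd (2 * s + 1)) hF
  have h16 : ∀ a : F, a ^ 16 = a := fun a => by
    have := FiniteField.pow_card a
    rwa [hF] at this
  have hfive : ∀ a : F, ψ (a ^ 5) = 1 := fun a =>
    addChar_eq_one_of_pow_four hψ hF (by linear_combination a ^ 4 * h16 a)
  have hlow := sum_addChar_cube_mul hψ hF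
  have hmod := sum_addChar_cube (ψ := ψ) hF
  rw [Int.modEq_iff_dvd] at hmod
  rw [ZMod.χ₈_nat_eq_if_mod_eight]
  norm_num at hpm
  obtain ⟨k, r, hr, rfl⟩ : ∃ k r, r < 4 ∧ s = 4 * k + r :=
    ⟨s / 4, s % 4, Nat.mod_lt _ (by norm_num), (Nat.div_add_mod s 4).symm⟩
  have hpow := fun a => pow_two_pow_add_of_pow_sixteen (h16 a)
  interval_cases r
  · have : ∀ a : F, ψ (suzukiForm (4 * k + 0) a) = ψ (a ^ 3) * ψ a := fun a => by
      rw [suzukiForm, show 2 * (4 * k + 0) + 1 = 4 * (2 * k) + 1 by ring, hpow, hpow, ← hψ a,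
        ← AddChar.map_add_eq_mul]
      ring_nf
    simp only [this] at hpm ⊢
    split_ifs <;> omega
  · have : ∀ a : F, ψ (suzukiForm (4 * k + 1) a) = ψ (a ^ 3) := fun a => by
      rw [suzukiForm, show 2 * (4 * k + 1) + 1 = 4 * (2 * k) + 3 by ring, hpow, hpow,
        ← mul_one (ψ (a ^ 3)), ← hfive a, ← hψ (a ^ 5), ← AddChar.map_add_eq_mul]
      ring_nf
    simp only [this] at hpm ⊢
    split_ifs <;> omega
  · have : ∀ a : F, ψ (suzukiForm (4 * k + 2) a) = ψ (a ^ 3) := fun a => by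
      rw [suzukiForm, show 2 * (4 * k + 2) + 1 = 4 * (2 * k + 1) + 1 by ring, hpow, hpow,
        ← mul_one (ψ (a ^ 3)), ← hfive a, ← hψ (a ^ 3), ← AddChar.map_add_eq_mul]
      ring_nf
    simp only [this] at hpm ⊢
    split_ifs <;> omega
  · have : ∀ a : F, ψ (suzukiForm (4 * k + 3) a) = ψ (a ^ 3) * ψ a := fun a => by
      have h9 : ψ (a ^ 3) = ψ (a ^ 9) := by
        rw [← hψ (a ^ 9)]
        congr 1
        linear_combination (-a ^ 2) * h16 a
      rw [suzukiForm, show 2 * (4 * k + 3) + 1 = 4 * (2 * k + 1) + 3 by ring, hpow, hpow, h9,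
        ← AddChar.map_add_eq_mul]
      congr 1
      linear_combination h16 a
    simp only [this] at hpm ⊢
    split_ifs <;> omega

end SignOfTheSum

section Induction

lemma two_pow_div_two_eq {p : ℕ} [Fact p.Prime] (hp : p ≠ 2) :
    ((2 : ZMod p) ^ (p / 2)) = ((ZMod.χ₈ (p : ZMod 8) : ℤ) : ZMod p) := by
  rw [← legendreSym.at_two hp, legendreSym.eq_pow]
  norm_num

lemma χ₈_mul_self {n : ℕ} (hn : Odd n) : ZMod.χ₈ (n : ZMod 8) * ZMod.χ₈ (n : ZMod 8) = 1 := by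
  rw [ZMod.χ₈_nat_eq_if_mod_eight]
  obtain ⟨k, rfl⟩ := hn
  split_ifs <;> omega

lemma neg_two_pow_mul_ne_self {p : ℕ} [Fact p.Prime] (hp : p ≠ 2) (e : ℕ) {ε : ℤ} (hε : ε * ε = 1) :
    ((-2 ^ e * ε : ℤ) : ZMod p) ≠ ((2 ^ e * ε : ℤ) : ZMod p) := by
  intro h
  have h2 : (2 : ZMod p) ≠ 0 := by
    intro h
    have := (ZMod.natCast_eq_zero_iff 2 p).1 (by exact_mod_cast h)
    exact hp ((Nat.prime_dvd_prime_iff_eq Fact.out Nat.prime_two).1 this)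
  have hε' : (ε : ZMod p) * ε = 1 := by exact_mod_cast congrArg (Int.cast : ℤ → ZMod p) hε
  refine pow_ne_zero (e + 1) h2 ?_
  push_cast at h
  linear_combination (-ε : ZMod p) * h - 2 ^ (e + 1) * hε'

/-- `S_F ≡ S_K` modulo `p`, where `K` is a subfield of prime index `p`. -/
lemma exists_subfield_sum_modEq {F : Type*} [Field F] [CharP F 2] [Fintype F] {ψ : AddChar F ℤ}
    (hψ : ∀ x, ψ (x ^ 2) = ψ x) (hψ1 : ψ ≠ 1) {n p : ℕ} [Fact p.Prime] (hp : p ≠ 2)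
    (hF : Fintype.card F = 2 ^ (4 * (n * p))) (s : ℕ) :
    ∃ (K : Subfield F) (_ : Fintype K) (ψ' : AddChar K ℤ), (∀ x, ψ' (x ^ 2) = ψ' x) ∧ ψ' ≠ 1 ∧
      Fintype.card K = 2 ^ (4 * n) ∧
      ∑ a : F, ψ (suzukiForm s a) ≡ ∑ a : K, ψ' (suzukiForm s a) [ZMOD p] := by
  classical
  let K : Subfield F := (iterateFrobenius F 2 (4 * n)).eqLocusField (RingHom.id F)
  have hK : ∀ x : F, x ∈ K ↔ x ^ 2 ^ (4 * n) = x := fun x => Iff.rfl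
  let ψ' : AddChar K ℤ := ψ.compAddMonoidHom K.subtype.toAddMonoidHom
  have hψ' : ∀ x : K, ψ' x = ψ x := fun x => rfl
  have hiter : ∀ (k : ℕ) (x : F), (fun x : F => x ^ 2 ^ (4 * n))^[k] x = x ^ 2 ^ (4 * n * k) := by
    intro k x
    induction k with
    | zero => simp
    | succ k ih => rw [Function.iterate_succ_apply', ih, ← pow_mul, ← pow_add]; rfl
  have hid : ∀ x : F, x ^ 2 ^ (4 * n * p) = x := fun x => by
    rw [mul_assoc, ← hF, FiniteField.pow_card]
  refine ⟨K, inferInstance, ψ', fun x => hψ x, ?_, ?_, ?_⟩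
  · obtain ⟨y, hy⟩ := AddChar.ne_one_iff.1 hψ1
    have hy : ψ y = -1 := (addChar_eq_one_or ψ y).resolve_left hy
    have hz : ∑ i ∈ Finset.range p, y ^ 2 ^ (4 * n * i) ∈ K := by
      rw [hK, ← iterateFrobenius_def, map_sum]
      simp only [iterateFrobenius_def, ← pow_mul, ← pow_add]
      have h1 := Finset.sum_range_succ' (fun i => y ^ 2 ^ (4 * n * i)) p
      have h2 := Finset.sum_range_succ (fun i => y ^ 2 ^ (4 * n * i)) p
      rw [h2, hid, mul_zero, pow_zero, pow_one] at h1
      exact (add_right_cancel h1).symm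
    refine AddChar.ne_one_iff.2 ⟨⟨_, hz⟩, ?_⟩
    rw [hψ']
    have hodd : Odd p := (Fact.out : p.Prime).odd_of_ne_two hp
    have hsum : ∀ k, ψ (∑ i ∈ Finset.range k, y ^ 2 ^ (4 * n * i)) = (-1) ^ k := by
      intro k
      induction k with
      | zero => simp
      | succ k ih =>
        rw [Finset.sum_range_succ, AddChar.map_add_eq_mul, ih, addChar_pow_two_pow hψ, hy, pow_succ]
    rw [hsum, hodd.neg_one_pow]
    norm_num
  · rw [← Nat.card_eq_fintype_card]
    have := card_pow_two_pow_eq_self hF (4 * n)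
    rw [← mul_assoc, Nat.gcd_mul_right_right] at this
    exact this
  · have := sum_modEq_sum_fixedPoints (p := p) (fun x : F => x ^ 2 ^ (4 * n))
      (by funext x; rw [hiter, hid]; rfl) (fun a => ψ (suzukiForm s a)) fun a => by
        rw [← addChar_pow_two_pow hψ (suzukiForm s a) (4 * n)]
        congr 1
        simp only [suzukiForm, mul_pow, add_pow_two_pow, pow_right_comm a (2 ^ (4 * n))]
    refine this.trans (congrArg (· % (p : ℤ)) ?_)
    exact Finset.sum_subtype _ (fun x => by simp [hK]) fun a => ψ (suzukiForm s a)

theorem sum_suzukiForm (n : ℕ) {F : Type*} [Field F] [CharP F 2] [Fintype F] {ψ : AddChar F ℤ}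
    (hψ : ∀ x, ψ (x ^ 2) = ψ x) (hψ1 : ψ ≠ 1) {s : ℕ} (hn : n ∣ 2 * s + 1)
    (hF : Fintype.card F = 2 ^ (4 * n)) :
    ∑ a : F, ψ (suzukiForm s a) =
      ZMod.χ₈ (n : ZMod 8) * ZMod.χ₈ ((2 * s + 1 : ℕ) : ZMod 8) * 2 ^ ((5 * n + 1) / 2) := by
  induction n using Nat.strong_induction_on generalizing F with
  | _ n ih =>
  by_cases hn1 : n = 1
  · subst hn1
    rw [sum_suzukiForm_sixteen hψ hψ1 hF]
    simp
  have hpm := sum_suzukiForm_eq_or hψ hψ1 hn hF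
  have hnodd : Odd n := Odd.of_dvd_nat ⟨s, rfl⟩ hn
  obtain ⟨p, hpp, k, rfl⟩ : ∃ p, p.Prime ∧ ∃ k, n = k * p :=
    ⟨n.minFac, Nat.minFac_prime hn1, n / n.minFac, (Nat.div_mul_cancel n.minFac_dvd).symm⟩
  have := Fact.mk hpp
  have hp2 : p ≠ 2 := by
    rintro rfl
    exact absurd hnodd (by simp)
  have hpodd : Odd p := hpp.odd_of_ne_two hp2
  have hkodd : Odd k := Nat.Odd.of_mul_left hnodd
  obtain ⟨K, _, ψ', hψ', hψ1', hK, hmod⟩ := exists_subfield_sum_modEq hψ hψ1 hp2 hF s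
  rw [ih k (lt_mul_of_one_lt_right hkodd.pos hpp.one_lt) hψ' hψ1' (dvd_of_mul_right_dvd hn) hK,
    ← ZMod.intCast_eq_intCast_iff] at hmod
  set ε := ZMod.χ₈ ((2 * s + 1 : ℕ) : ZMod 8)
  have hε : ε * ε = 1 := χ₈_mul_self ⟨s, rfl⟩
  have hk := χ₈_mul_self hkodd
  have hp := χ₈_mul_self hpodd
  rw [Nat.cast_mul, map_mul]
  set η := ZMod.χ₈ (k : ZMod 8)
  set θ := ZMod.χ₈ (p : ZMod 8) with hθ
  have hpow : ((2 : ZMod p) ^ ((5 * (k * p) + 1) / 2)) = 2 ^ ((5 * k + 1) / 2) * θ := by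
    obtain ⟨j, hj⟩ := hkodd
    obtain ⟨l, hl⟩ := hpodd
    have hl' : p / 2 = l := by omega
    have e1 : (5 * (k * p) + 1) / 2 = (5 * k + 1) / 2 + l * (5 * k) := by
      rw [hl, mul_add, mul_one, show 5 * (k * (2 * l) + k) + 1 = 5 * k + 1 + 2 * (l * (5 * k)) by
        ring, Nat.add_mul_div_left _ _ two_pos]
    have e2 : (5 : ℕ) * k = 2 * (5 * j + 2) + 1 := by omega
    have hp' : (θ : ZMod p) * θ = 1 := by exact_mod_cast congrArg (Int.cast : ℤ → ZMod p) hp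
    rw [e1, pow_add, pow_mul, ← hl', two_pow_div_two_eq hp2, ← hθ, e2, pow_succ, pow_mul, pow_two,
      hp', one_pow, one_mul]
  have h1 : (η * θ * ε) * (η * θ * ε) = 1 := by
    linear_combination θ ^ 2 * ε ^ 2 * hk + ε ^ 2 * hp + hε
  have hsign : ∑ a : F, ψ (suzukiForm s a) ≠ -(η * θ * ε * 2 ^ ((5 * (k * p) + 1) / 2)) := by
    intro h
    rw [h] at hmod
    refine neg_two_pow_mul_ne_self hp2 ((5 * (k * p) + 1) / 2) h1 ?_
    push_cast at hmod ⊢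
    rw [hpow] at hmod ⊢
    have hp' : (θ : ZMod p) * θ = 1 := by exact_mod_cast congrArg (Int.cast : ℤ → ZMod p) hp
    linear_combination hmod - (η * ε * 2 ^ ((5 * k + 1) / 2)) * hp'
  rcases mul_self_eq_one_iff.1 h1 with h | h
  · rw [h] at hsign ⊢
    rcases hpm with h' | h'
    · rw [h', one_mul]
    · exact absurd h' (by simpa using hsign)
  · rw [h] at hsign ⊢
    rcases hpm with h' | h'
    · exact absurd h' (by simpa using hsign)
    · rw [h', neg_one_mul]

end Induction

section PowerResidue

variable {F : Type*} [Field F] [CharP F 2]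

/-- If `Φ` and `τ` play the role of the `q`- and `q₀`-power maps and `Φ b + b = τ a (Φ a + a)`, then
`v = u^{q + 2 q₀ + 1}` with `u = Φ a + a` is fixed by `Φ²`. -/
lemma twice_frobenius_eq_self {Φ τ : F →+* F} (hcomm : ∀ x, τ (Φ x) = Φ (τ x))
    (hτ : ∀ x, τ (τ x) ^ 2 = Φ x) (hΦ : ∀ x, Φ (Φ (Φ (Φ x))) = x) {a b : F}
    (hab : Φ b + b = τ a * (Φ a + a)) (hu : Φ a + a ≠ 0) :
    Φ (Φ (Φ (Φ a + a) * τ (Φ a + a) ^ 2 * (Φ a + a))) =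
      Φ (Φ a + a) * τ (Φ a + a) ^ 2 * (Φ a + a) := by
  have h2 := CharTwo.two_eq_zero (R := F)
  obtain ⟨u, hu_def⟩ : ∃ u, u = Φ a + a := ⟨_, rfl⟩
  have hb1 := congrArg Φ hab
  have hb2 := congrArg Φ hb1
  have hb3 := congrArg Φ hb2
  have hu1 := congrArg Φ hu_def
  have hu2 := congrArg Φ hu1
  have hu3 := congrArg Φ hu2
  have hU0 := congrArg τ hu_def
  have hU1 := congrArg Φ hU0
  have hU2 := congrArg Φ hU1
  have hU3 := congrArg Φ hU2
  rw [← hu_def] at hab hb1 hb2 hb3 hu ⊢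
  simp only [map_add, map_mul, map_pow, hΦ, hcomm] at hb1 hb2 hb3 hu1 hu2 hu3 hU0 hU1 hU2 hU3 ⊢
  have hsum : u + Φ u + Φ (Φ u) + Φ (Φ (Φ u)) = 0 := by grobner
  have hUsum : τ u + Φ (τ u) + Φ (Φ (τ u)) + Φ (Φ (Φ (τ u))) = 0 := by grobner
  have hW : u * Φ (Φ (Φ (τ u))) + Φ u * (τ u + Φ (Φ (Φ (τ u)))) + Φ (Φ u) * Φ (Φ (τ u)) = 0 := by
    grobner
  have hW2 := congrArg (fun x => τ x ^ 2) hW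
  simp only [map_add, map_mul, map_zero, hcomm, CharTwo.add_sq, mul_pow, ← map_pow Φ, hτ, hΦ] at hW2
  simp only [map_pow] at hW2
  have hR : u * Φ (Φ (Φ (τ u))) * (τ u + Φ (τ u)) = Φ u * Φ (τ u) * (Φ (τ u) + Φ (Φ (τ u))) := by
    grobner
  by_cases hfix : Φ u = u
  · simp only [hfix, ← hcomm]
  have hne : τ u + Φ (τ u) ≠ 0 := by
    rw [Ne, CharTwo.add_eq_zero, ← hcomm]
    exact fun h => hfix (τ.injective h).symm
  have hne' : Φ (τ u) + Φ (Φ (τ u)) ≠ 0 := by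
    rw [← map_add]
    exact (map_ne_zero Φ).2 hne
  have hR1 := congrArg Φ hR
  simp only [map_add, map_mul, hΦ] at hR1
  have hu1' : Φ u ≠ 0 := (map_ne_zero Φ).2 hu
  have hT : u * Φ (Φ (Φ (τ u))) * τ u = Φ (Φ u) * Φ (τ u) * Φ (Φ (τ u)) := by
    refine mul_left_cancel₀ (mul_ne_zero (mul_ne_zero hne hne') hu1') ?_
    have : Φ (Φ (τ u)) + Φ (Φ (Φ (τ u))) = τ u + Φ (τ u) := by grobner
    rw [this] at hR1
    linear_combination Φ u * τ u * (Φ (τ u) + Φ (Φ (τ u))) * hR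
      + Φ u * Φ (τ u) * (Φ (τ u) + Φ (Φ (τ u))) * hR1
  have hT1 := congrArg Φ hT
  simp only [map_mul, hΦ] at hT1
  have hU0 : τ u ≠ 0 := (map_ne_zero τ).2 hu
  have hU1 : Φ (τ u) ≠ 0 := (map_ne_zero Φ).2 hU0
  have hU3 : Φ (Φ (Φ (τ u))) ≠ 0 := (map_ne_zero Φ).2 ((map_ne_zero Φ).2 hU1)
  refine mul_left_cancel₀ (mul_ne_zero hU1 hU3) ?_
  linear_combination -(Φ u * Φ (τ u) * τ u) * hT - Φ (Φ u) * Φ (τ u) * Φ (Φ (τ u)) * hT1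

end PowerResidue

section PointCount

variable {F : Type*} [Field F] [CharP F 2] [Fintype F]

lemma two_pow_eq_two_mul_sq (s : ℕ) : 2 ^ (2 * s + 1) = 2 * (2 ^ s) ^ 2 := by
  rw [pow_succ, mul_comm 2 s, pow_mul, mul_comm]

lemma cofactor_mul (Q : ℕ) (hQ : 0 < Q) :
    ((2 * Q ^ 2) ^ 2 - 1) * (2 * Q ^ 2 + 2 * Q + 1) * (2 * Q ^ 2 - 2 * Q + 1) =
      (2 * Q ^ 2) ^ 4 - 1 := by
  have h1 : 2 * Q ≤ 2 * Q ^ 2 := by nlinarith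
  have h2 : 1 ≤ (2 * Q ^ 2) ^ 2 := Nat.one_le_pow _ _ (by positivity)
  have h4 : 1 ≤ (2 * Q ^ 2) ^ 4 := Nat.one_le_pow _ _ (by positivity)
  zify [h1, h2, h4]
  ring

lemma pow_cofactor_eq_one {s : ℕ} (hF : Fintype.card F = 2 ^ (4 * (2 * s + 1))) {a b : F}
    (hab : b ^ 2 ^ (2 * s + 1) + b = suzukiForm s a) (hu : a ^ 2 ^ (2 * s + 1) + a ≠ 0) :
    (a ^ 2 ^ (2 * s + 1) + a) ^
      (((2 * (2 ^ s) ^ 2) ^ 2 - 1) * (2 * (2 ^ s) ^ 2 + 2 * 2 ^ s + 1)) = 1 := by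
  have h := twice_frobenius_eq_self (Φ := iterateFrobenius F 2 (2 * s + 1))
    (τ := iterateFrobenius F 2 s) (a := a) (b := b)
    (fun x => pow_right_comm ..)
    (fun x => by
      simp only [iterateFrobenius_def, ← pow_mul]
      ring_nf)
    (fun x => by
      simp only [iterateFrobenius_def, ← pow_mul, ← pow_add]
      rw [show 2 * s + 1 + (2 * s + 1) + (2 * s + 1) + (2 * s + 1) = 4 * (2 * s + 1) by ring, ← hF,
        FiniteField.pow_card])
    hab hu
  simp only [iterateFrobenius_def] at h
  set u := a ^ 2 ^ (2 * s + 1) + a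
  rw [← pow_mul u, ← pow_add, ← pow_succ, ← pow_mul _ (2 ^ (2 * s + 1)), ← pow_add,
    pow_two_pow_eq_self_iff (pow_ne_zero _ hu), ← pow_mul] at h
  rw [← h]
  congr 1
  rw [pow_add 2 (2 * s + 1), two_pow_eq_two_mul_sq, mul_comm, mul_comm (2 ^ s) 2, sq (2 * _)]

omit [CharP F 2] in
lemma sum_mul_suzukiForm {ψ : AddChar F ℤ} {s : ℕ} {l : F} (hl : l ^ 2 ^ (2 * s + 1) = l)
    (hl0 : l ≠ 0) :
    ∑ a : F, ψ (l * suzukiForm s a) = ∑ a : F, ψ (suzukiForm s a) := by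
  set μ : F := l⁻¹ ^ (2 * (2 ^ s - 1)) with hμ
  have hμ0 : μ ≠ 0 := pow_ne_zero _ (inv_ne_zero hl0)
  have hμq : μ ^ 2 ^ (2 * s + 1) = μ := by
    rw [hμ, pow_right_comm, inv_pow, hl]
  have hμl : μ ^ 2 ^ s * μ = l := by
    have he : 2 * (2 ^ s - 1) * (2 ^ s + 1) + 2 = 2 ^ (2 * s + 1) := by
      rw [two_pow_eq_two_mul_sq]
      have : 1 ≤ 2 ^ s := Nat.one_le_two_pow
      zify [this]
      ring
    rw [← pow_succ, hμ, ← pow_mul, inv_pow]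
    refine inv_eq_of_mul_eq_one_left (mul_left_cancel₀ hl0 ?_)
    rw [← pow_succ', ← pow_succ', add_assoc, he, hl, mul_one]
  refine Eq.trans (Finset.sum_congr rfl fun a _ => congrArg ψ ?_)
    (Equiv.sum_comp (Equiv.mulLeft₀ μ hμ0) fun a => ψ (suzukiForm s a))
  simp only [Equiv.mulLeft₀_apply, suzukiForm, mul_pow, hμq]
  rw [← hμl]
  ring

lemma card_curve_eq_sum [DecidableEq F] {ψ : AddChar F ℤ} (hψ : ∀ x, ψ (x ^ 2) = ψ x) (hψ1 : ψ ≠ 1)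
    (s : ℕ) :
    (Nat.card {t : F × F // t.2 ^ 2 ^ (2 * s + 1) + t.2 = suzukiForm s t.1} : ℤ) =
      ∑ l : F with l ^ 2 ^ (2 * s + 1) = l, ∑ a, ψ (l * suzukiForm s a) := by
  have hF0 : (Fintype.card F : ℤ) ≠ 0 := Nat.cast_ne_zero.2 Fintype.card_ne_zero
  refine mul_right_cancel₀ hF0 ?_
  have hb : ∀ l : F, ∑ b : F, ψ (l * (b ^ 2 ^ (2 * s + 1) + b)) =
      if l ^ 2 ^ (2 * s + 1) = l then (Fintype.card F : ℤ) else 0 := by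
    intro l
    simp only [← CharTwo.add_eq_zero (a := l ^ 2 ^ (2 * s + 1))]
    rw [← sum_addChar_pow_mul hψ1 (2 * s + 1)]
    refine Finset.sum_congr rfl fun b _ => ?_
    rw [mul_add, mul_add, AddChar.map_add_eq_mul, AddChar.map_add_eq_mul, ← mul_pow,
      addChar_pow_two_pow hψ, mul_comm, mul_comm l b, mul_comm l]
  calc _ = ∑ t : F × F, if t.2 ^ 2 ^ (2 * s + 1) + t.2 + suzukiForm s t.1 = 0 then
          (Fintype.card F : ℤ) else 0 := by
        simp only [CharTwo.add_eq_zero]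
        rw [Nat.card_eq_fintype_card, Fintype.card_subtype, ← Finset.sum_filter, Finset.sum_const,
          nsmul_eq_mul]
    _ = ∑ t : F × F, ∑ l : F, ψ (l * (t.2 ^ 2 ^ (2 * s + 1) + t.2 + suzukiForm s t.1)) := by
        refine Finset.sum_congr rfl fun t _ => ?_
        rw [AddChar.sum_mulShift _ (AddChar.IsPrimitive.of_ne_one hψ1)]
        split_ifs <;> simp
    _ = ∑ l : F, (∑ b : F, ψ (l * (b ^ 2 ^ (2 * s + 1) + b))) * ∑ a, ψ (l * suzukiForm s a) := by
        rw [Finset.sum_comm]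
        refine Finset.sum_congr rfl fun l _ => ?_
        rw [Finset.sum_mul_sum, Finset.sum_comm, Fintype.sum_prod_type]
        simp only [mul_add l (_ + _), AddChar.map_add_eq_mul]
    _ = _ := by
        simp only [hb, ite_mul, zero_mul]
        rw [← Finset.sum_filter, Finset.sum_mul]
        simp only [mul_comm]

lemma card_curve {s : ℕ} (hF : Fintype.card F = 2 ^ (4 * (2 * s + 1))) :
    Nat.card {t : F × F // t.2 ^ 2 ^ (2 * s + 1) + t.2 = suzukiForm s t.1} =
      2 ^ (4 * (2 * s + 1)) + (2 ^ (2 * s + 1) - 1) * 2 ^ (5 * s + 3) := by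
  classical
  obtain ⟨ψ, hψ, hψ1⟩ := exists_frobenius_invariant_addChar F
  have hS := sum_suzukiForm (2 * s + 1) hψ hψ1 dvd_rfl hF
  rw [χ₈_mul_self ⟨s, rfl⟩, one_mul, show (5 * (2 * s + 1) + 1) / 2 = 5 * s + 3 by omega] at hS
  zify [Nat.one_le_two_pow (n := 2 * s + 1)]
  have h0 : (0 : F) ∈ ({l | l ^ 2 ^ (2 * s + 1) = l} : Finset F) := by simp
  have hq := card_pow_two_pow_eq_self hF (2 * s + 1)
  rw [Nat.gcd_mul_left_right, Nat.card_eq_fintype_card, Fintype.card_subtype] at hq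
  rw [card_curve_eq_sum hψ hψ1, ← Finset.add_sum_erase _ _ h0]
  congr 1
  · simp [hF]
  · rw [Finset.sum_congr rfl fun l hl => (sum_mul_suzukiForm
      (Finset.mem_filter.1 (Finset.mem_of_mem_erase hl)).2 (Finset.ne_of_mem_erase hl)).trans hS,
      Finset.sum_const, Finset.card_erase_of_mem h0, hq, nsmul_eq_mul,
      Nat.cast_sub Nat.one_le_two_pow]
    push_cast
    rfl

lemma card_curve_rational {s : ℕ} (hF : Fintype.card F = 2 ^ (4 * (2 * s + 1))) :
    Nat.card {t : F × F // t.2 ^ 2 ^ (2 * s + 1) + t.2 = suzukiForm s t.1 ∧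
      t.1 ^ 2 ^ (2 * s + 1) + t.1 = 0} = (2 ^ (2 * s + 1)) ^ 2 := by
  have hq := card_pow_two_pow_eq_self hF (2 * s + 1)
  rw [Nat.gcd_mul_left_right] at hq
  rw [sq]
  refine Eq.trans (Nat.card_congr ?_) ((Nat.card_prod _ _).trans (congrArg₂ (· * ·) hq hq))
  exact
    { toFun := fun t => (⟨t.1.1, CharTwo.add_eq_zero.1 t.2.2⟩, ⟨t.1.2, CharTwo.add_eq_zero.1 (by
        rw [t.2.1, suzukiForm, t.2.2, mul_zero])⟩)
      invFun := fun t => ⟨(t.1.1, t.2.1), by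
        simp only [suzukiForm, t.1.2, t.2.2, CharTwo.add_self_eq_zero, mul_zero, and_self]⟩
      left_inv := fun t => rfl
      right_inv := fun t => rfl }

lemma card_curve_not_rational {s : ℕ} (hF : Fintype.card F = 2 ^ (4 * (2 * s + 1))) :
    Nat.card {t : F × F // t.2 ^ 2 ^ (2 * s + 1) + t.2 = suzukiForm s t.1 ∧
      t.1 ^ 2 ^ (2 * s + 1) + t.1 ≠ 0} =
      2 ^ (4 * (2 * s + 1)) + (2 ^ (2 * s + 1) - 1) * 2 ^ (5 * s + 3) - (2 ^ (2 * s + 1)) ^ 2 := by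
  classical
  rw [← card_curve hF, ← card_curve_rational hF]
  simp only [Nat.card_eq_fintype_card, Fintype.card_subtype]
  rw [← Finset.card_filter_add_card_filter_not
    (s := {t : F × F | t.2 ^ 2 ^ (2 * s + 1) + t.2 = suzukiForm s t.1})
    (fun t : F × F => t.1 ^ 2 ^ (2 * s + 1) + t.1 = 0), Finset.filter_filter, Finset.filter_filter,
    Nat.add_sub_cancel_left]

lemma card_cover {s : ℕ} (hF : Fintype.card F = 2 ^ (4 * (2 * s + 1))) :
    Nat.card {t : F × F × F // t.2.1 ^ 2 ^ (2 * s + 1) + t.2.1 = suzukiForm s t.1 ∧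
      t.2.2 ^ (2 * (2 ^ s) ^ 2 - 2 * 2 ^ s + 1) = t.1 ^ 2 ^ (2 * s + 1) + t.1 ∧ t.2.2 ≠ 0} =
      (2 * (2 ^ s) ^ 2 - 2 * 2 ^ s + 1) *
        (2 ^ (4 * (2 * s + 1)) + (2 ^ (2 * s + 1) - 1) * 2 ^ (5 * s + 3)
          - (2 ^ (2 * s + 1)) ^ 2) := by
  classical
  set m := 2 * (2 ^ s) ^ 2 - 2 * 2 ^ s + 1
  have hm : ((2 * (2 ^ s) ^ 2) ^ 2 - 1) * (2 * (2 ^ s) ^ 2 + 2 * 2 ^ s + 1) * m =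
      Fintype.card F - 1 := by
    rw [cofactor_mul _ (by positivity), hF, mul_comm 4, pow_mul, two_pow_eq_two_mul_sq]
  have e : {t : F × F × F // t.2.1 ^ 2 ^ (2 * s + 1) + t.2.1 = suzukiForm s t.1 ∧
      t.2.2 ^ m = t.1 ^ 2 ^ (2 * s + 1) + t.1 ∧ t.2.2 ≠ 0} ≃
      Σ t : {t : F × F // t.2 ^ 2 ^ (2 * s + 1) + t.2 = suzukiForm s t.1 ∧
        t.1 ^ 2 ^ (2 * s + 1) + t.1 ≠ 0},
      {c : F // c ^ m = t.1.1 ^ 2 ^ (2 * s + 1) + t.1.1 ∧ c ≠ 0} :=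
    { toFun := fun t => ⟨⟨(t.1.1, t.1.2.1), t.2.1, t.2.2.1 ▸ pow_ne_zero _ t.2.2.2⟩,
        ⟨t.1.2.2, t.2.2⟩⟩
      invFun := fun t => ⟨(t.1.1.1, t.1.1.2, t.2.1), t.1.2.1, t.2.2⟩
      left_inv := fun t => rfl
      right_inv := fun t => rfl }
  rw [Nat.card_congr e, Nat.card_sigma, ← card_curve_not_rational hF, mul_comm m,
    Nat.card_eq_fintype_card]
  refine Finset.sum_const_nat fun t _ => card_pow_eq_of_ne_zero (Dvd.intro_left _ hm)
    (Nat.succ_pos _) t.2.2 ?_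
  rw [← hm, Nat.mul_div_cancel _ (Nat.succ_pos _)]
  exact pow_cofactor_eq_one hF t.2.1 t.2.2

lemma count_identity (Q q : ℕ) (hQ : 0 < Q) (hq : q = 2 * Q ^ 2) :
    q ^ 5 - q ^ 4 + q ^ 3 - q ^ 2 =
      (q - 2 * Q + 1) * (q ^ 4 + 2 * Q * q ^ 2 * (q - 1) - q ^ 2) := by
  have h1 : 2 * Q ≤ q := by subst hq; nlinarith
  have h2 : 1 ≤ q := by omega
  have h3 : q ^ 4 ≤ q ^ 5 := Nat.pow_le_pow_right h2 (by norm_num)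
  have h4 : q ^ 2 ≤ q ^ 3 := Nat.pow_le_pow_right h2 (by norm_num)
  have h5 : q ^ 2 ≤ q ^ 4 := Nat.pow_le_pow_right h2 (by norm_num)
  have h6 : q ^ 2 ≤ q ^ 5 - q ^ 4 + q ^ 3 := h4.trans (Nat.le_add_left _ _)
  have h7 : q ^ 2 ≤ q ^ 4 + 2 * Q * q ^ 2 * (q - 1) := h5.trans (Nat.le_add_right _ _)
  zify [h1, h2, h3, h6, h7]
  have hq' : (q : ℤ) = 2 * Q ^ 2 := by exact_mod_cast hq
  rw [hq']
  ring

end PointCount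

end SuzukiCount

/-- For `q_0 = 2^s`, `q = 2 q_0²`, `m = q − 2q_0 + 1`, and `F_{q⁴}` the field with `q⁴`
elements, the number of triples `(a,b,c) ∈ F_{q⁴}³` with `b^q + b = a^{q_0}(a^q + a)`,
`c^m = a^q + a`, and `c ≠ 0` (the affine `F_{q⁴}`-points of Skabelund's cover `S̃_q` that
are not `F_q`-rational) equals `q⁵ − q⁴ + q³ − q²`, which also equals
`(q − 2q_0 + 1)(q⁴ + 2 q_0 q² (q − 1) − q²)`. -/
theorem skabelund_suzuki_point_count (s : ℕ) (hs : 0 < s) (q0 q m : ℕ)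
    (hq0 : q0 = 2 ^ s) (hq : q = 2 * q0 ^ 2) (hm : m = q - 2 * q0 + 1)
    (F : Type*) [Field F] [Fintype F] (hF : Fintype.card F = q ^ 4) :
    Nat.card {t : F × F × F // t.2.1 ^ q + t.2.1 = t.1 ^ q0 * (t.1 ^ q + t.1)
        ∧ t.2.2 ^ m = t.1 ^ q + t.1 ∧ t.2.2 ≠ 0}
      = q ^ 5 - q ^ 4 + q ^ 3 - q ^ 2
    ∧ q ^ 5 - q ^ 4 + q ^ 3 - q ^ 2
      = (q - 2 * q0 + 1) * (q ^ 4 + 2 * q0 * q ^ 2 * (q - 1) - q ^ 2) := by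
  have hid := SuzukiCount.count_identity q0 q (by rw [hq0]; positivity) hq
  refine ⟨?_, hid⟩
  have hq2 : q = 2 ^ (2 * s + 1) := by rw [hq, hq0, SuzukiCount.two_pow_eq_two_mul_sq]
  have hF2 : Fintype.card F = 2 ^ (4 * (2 * s + 1)) := by
    rw [hF, hq2, ← pow_mul, mul_comm]
  have : CharP F 2 := charP_of_card_eq_prime_pow hF2
  have h := SuzukiCount.card_cover hF2
  have hS : 2 ^ (5 * s + 3) = 2 * q0 * q ^ 2 := by
    rw [hq, hq0]
    ring
  rw [hS, ← hF2, hF, ← hq2, ← hq0, ← hq, ← hm, mul_comm (q - 1)] at h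
  rw [hid, ← hm, ← h]
  simp only [SuzukiCount.suzukiForm, ← hq2, ← hq0]
end
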